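/- arXiv:0709.0170 — 5 statements merged into one kernel-verified Lean document; each statement's English description precedes it below -/
import Mathlib

section
/- Let l ≥ 1 be an integer and let C be a noncrossing set of chords of the path 1,2,…,l. Let G_C be the simple graph on vertex set {1,…,l} with edge set C, let c be the number of connected components of G_C, and let m be the number of vertices of G_C incident to no chord of C (its isolated vertices). Then m ≥ |C| − l + c + 1; that is, the number of isolated vertices of G_C exceeds its cycle rank |C| − l + c (the number of bounded faces in a plane drawing of G_C) by at least one. -/
/-- `c = (i, j)` is a chord of the path `1, 2, …, l`: `1 ≤ i` and `i + 2 ≤ j ≤ l`. -/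
def IsChord (l : ℕ) (c : ℕ × ℕ) : Prop := 1 ≤ c.1 ∧ c.1 + 2 ≤ c.2 ∧ c.2 ≤ l

/-- Two chords `{i,j}` (`i < j`) and `{a,b}` (`a < b`) cross if
`i < a < j < b` or `a < i < b < j`. -/
def ChordsCross (c d : ℕ × ℕ) : Prop :=
  (c.1 < d.1 ∧ d.1 < c.2 ∧ c.2 < d.2) ∨ (d.1 < c.1 ∧ c.1 < d.2 ∧ d.2 < c.2)

open Classical in
noncomputable def ncZ (C : Finset (ℕ × ℕ)) (P : ℕ × ℕ → Prop) (a b : ℕ) : Finset (ℕ × ℕ) :=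
  C.filter (fun e => P e ∧ a ≤ e.1 ∧ e.2 ≤ b)

open Classical in
noncomputable def ncI (C : Finset (ℕ × ℕ)) (a b : ℕ) : Finset ℕ :=
  (Finset.Ioo a b).filter (fun v => ∀ d ∈ C, a ≤ d.1 → d.2 ≤ b → d.1 ≠ v ∧ d.2 ≠ v)

def ncCyc (C : Finset (ℕ × ℕ)) (e : ℕ × ℕ) : Prop :=
  ∀ t, e.1 ≤ t → t < e.2 → ∃ d ∈ C, d ≠ e ∧ e.1 ≤ d.1 ∧ d.1 ≤ t ∧ t < d.2 ∧ d.2 ≤ e.2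

theorem ncZ_empty (C : Finset (ℕ × ℕ)) (hC : ∀ c ∈ C, c.1 + 2 ≤ c.2) (P) (a b : ℕ)
    (h : b < a + 2) : ncZ C P a b = ∅ := by
  ext x
  simp only [ncZ, Finset.mem_filter, Finset.notMem_empty, iff_false]
  rintro ⟨h1, -, h2, h3⟩
  have := hC x h1
  omega

theorem nc_main (C : Finset (ℕ × ℕ)) (hC : ∀ c ∈ C, c.1 + 2 ≤ c.2)
    (hnc : ∀ c ∈ C, ∀ d ∈ C, c ≠ d → ¬ ChordsCross c d) (n : ℕ) :
    ∀ a b : ℕ, b ≤ a + n → a + 2 ≤ b → (ncZ C (ncCyc C) a b).card + 1 ≤ (ncI C a b).card := by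
  classical
  induction n with
  | zero => intro a b h1 h2; omega
  | succ n ih =>
    intro a b hn hab
    by_cases hcov : ncCyc C (a, b)
    · -- covered
      obtain ⟨d0, hd0, hd0ne, h1, h2, h3, h4⟩ := hcov a le_rfl (by simp; omega)
      simp only at h1 h2 h3 h4
      have hne : (C.filter (fun d => d.1 = a ∧ d.2 < b)).Nonempty := by
        refine ⟨d0, ?_⟩
        simp only [Finset.mem_filter]
        refine ⟨hd0, by omega, lt_of_le_of_ne h4 ?_⟩
        intro h; exact hd0ne (Prod.ext (by simp; omega) (by simpa using h))
      obtain ⟨⟨a', v⟩, hm, hmax⟩ := Finset.exists_max_image _ (fun d : ℕ × ℕ => d.2) hne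
      simp only [Finset.mem_filter] at hm hmax
      obtain ⟨hav, rfl, hvb⟩ := hm
      have hav2 := hC _ hav
      simp only at hav2
      have hsplit : ∀ x ∈ C, a' ≤ x.1 → x.2 ≤ b → x ≠ (a', b) → x.2 ≤ v ∨ v ≤ x.1 := by
        intro x hx hx1 hx2 hxne
        by_contra hcon
        push Not at hcon
        by_cases hxa : x.1 = a'
        · by_cases hxb : x.2 = b
          · exact hxne (Prod.ext hxa hxb)
          · have := hmax x ⟨hx, hxa, by omega⟩
            omega
        · refine hnc _ hav x hx ?_ (Or.inl ⟨?_, ?_, ?_⟩)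
          · rintro rfl; simp at hxa
          all_goals simp only
          all_goals omega
      obtain ⟨e, he, hene, e1, e2, e3, e4⟩ := hcov v (by simp; omega) (by simpa using hvb)
      simp only at e1 e4
      have hev : e.1 = v := by
        rcases hsplit e he e1 e4 hene with h | h <;> omega
      have he2 := hC e he
      have i1 := ih a' v (by omega) (by omega)
      have i2 := ih v b (by omega) (by omega)
      have hZ : ncZ C (ncCyc C) a' b ⊆
          insert (a', b) (ncZ C (ncCyc C) a' v ∪ ncZ C (ncCyc C) v b) := by
        intro x
        simp only [ncZ, Finset.mem_filter, Finset.mem_insert, Finset.mem_union]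
        rintro ⟨hx, hp, hx1, hx2⟩
        by_cases hxne : x = (a', b)
        · exact Or.inl hxne
        · right
          rcases hsplit x hx hx1 hx2 hxne with h | h
          · exact Or.inl ⟨hx, hp, hx1, h⟩
          · exact Or.inr ⟨hx, hp, h, hx2⟩
      have hI : ncI C a' v ∪ ncI C v b ⊆ ncI C a' b := by
        intro u
        simp only [ncI, Finset.mem_filter, Finset.mem_union, Finset.mem_Ioo]
        rintro (⟨⟨u1, u2⟩, hu⟩ | ⟨⟨u1, u2⟩, hu⟩)
        all_goals
          refine ⟨⟨by omega, by omega⟩, ?_⟩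
          intro x hx hx1 hx2
          have := hC x hx
          by_cases hxne : x = (a', b)
          · subst hxne; simp only; omega
          · have := hu x hx
            rcases hsplit x hx hx1 hx2 hxne with h | h <;> omega
      have hdis : Disjoint (ncI C a' v) (ncI C v b) := by
        rw [Finset.disjoint_left]
        intro u
        simp only [ncI, Finset.mem_filter, Finset.mem_Ioo]
        rintro ⟨⟨u1, u2⟩, hu⟩ ⟨⟨u3, u4⟩, hu'⟩
        omega
      have c1 := Finset.card_le_card hZ
      have c2 := Finset.card_le_card hI
      rw [Finset.card_union_of_disjoint hdis] at c2
      have c3 := Finset.card_insert_le (a', b) (ncZ C (ncCyc C) a' v ∪ ncZ C (ncCyc C) v b)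
      have c4 := Finset.card_union_le (ncZ C (ncCyc C) a' v) (ncZ C (ncCyc C) v b)
      omega
    · have hcov' := hcov
      unfold ncCyc at hcov'
      push Not at hcov'
      obtain ⟨t, t1, t2, ht⟩ := hcov'
      simp only at t1 t2 ht
      have hsplit : ∀ x ∈ C, a ≤ x.1 → x.2 ≤ b → x ≠ (a, b) → x.2 ≤ t ∨ t + 1 ≤ x.1 := by
        intro x hx hx1 hx2 hxne
        by_contra hcon
        have := ht x hx hxne hx1 (by omega) (by omega)
        omega
      have hZ : ncZ C (ncCyc C) a b ⊆ ncZ C (ncCyc C) a t ∪ ncZ C (ncCyc C) (t+1) b := by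
        intro x
        simp only [ncZ, Finset.mem_filter, Finset.mem_union]
        rintro ⟨hx, hp, hx1, hx2⟩
        have hxne : x ≠ (a, b) := by rintro rfl; exact hcov hp
        rcases hsplit x hx hx1 hx2 hxne with h | h
        · exact Or.inl ⟨hx, hp, hx1, h⟩
        · exact Or.inr ⟨hx, hp, h, hx2⟩
      have hI : ncI C a t ∪ ncI C (t+1) b ⊆ ncI C a b := by
        intro u
        simp only [ncI, Finset.mem_filter, Finset.mem_union, Finset.mem_Ioo]
        rintro (⟨⟨u1, u2⟩, hu⟩ | ⟨⟨u1, u2⟩, hu⟩)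
        all_goals
          refine ⟨⟨by omega, by omega⟩, ?_⟩
          intro x hx hx1 hx2
          have := hC x hx
          by_cases hxne : x = (a, b)
          · subst hxne; simp only; omega
          · have := hu x hx
            rcases hsplit x hx hx1 hx2 hxne with h | h <;> omega
      have hdis : Disjoint (ncI C a t) (ncI C (t+1) b) := by
        rw [Finset.disjoint_left]
        intro u
        simp only [ncI, Finset.mem_filter, Finset.mem_Ioo]
        rintro ⟨⟨u1, u2⟩, hu⟩ ⟨⟨u3, u4⟩, hu'⟩
        omega
      have c1 := Finset.card_le_card hZ
      have c2 := Finset.card_le_card hI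
      rw [Finset.card_union_of_disjoint hdis] at c2
      have c4 := Finset.card_union_le (ncZ C (ncCyc C) a t) (ncZ C (ncCyc C) (t+1) b)
      have k1 : t < a + 2 → (ncZ C (ncCyc C) a t).card = 0 := fun h => by
        rw [ncZ_empty C hC _ _ _ h]; rfl
      have k2 : b < t + 1 + 2 → (ncZ C (ncCyc C) (t+1) b).card = 0 := fun h => by
        rw [ncZ_empty C hC _ _ _ h]; rfl
      have i1 := ih a t (by omega)
      have i2 := ih (t+1) b (by omega)
      by_cases q1 : a + 2 ≤ t
      · by_cases q2 : t + 1 + 2 ≤ b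
        · omega
        · omega
      · by_cases q2 : t + 1 + 2 ≤ b
        · omega
        · have : a + 1 ∈ ncI C a b := by
            simp only [ncI, Finset.mem_filter, Finset.mem_Ioo]
            refine ⟨by omega, ?_⟩
            intro x hx hx1 hx2
            have := hC x hx
            by_cases hxne : x = (a, b)
            · subst hxne; simp only; omega
            · rcases hsplit x hx hx1 hx2 hxne with h | h <;> omega
          have := Finset.card_pos.mpr ⟨_, this⟩
          omega

theorem nc_comp (l : ℕ) (C : Finset (ℕ × ℕ)) (hC : ∀ c ∈ C, IsChord l c)
    (hnc : ∀ c ∈ C, ∀ d ∈ C, c ≠ d → ¬ ChordsCross c d)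
    (G : SimpleGraph {i : ℕ // i ∈ Finset.Icc 1 l})
    (hG : ∀ u v : {i : ℕ // i ∈ Finset.Icc 1 l}, ((u : ℕ), (v : ℕ)) ∈ C → G.Adj u v)
    (N : Finset (ℕ × ℕ)) (hN : ∀ e ∈ N, e ∈ C ∧ ¬ ncCyc C e) :
    Nat.card G.ConnectedComponent + N.card ≤ l := by
  classical
  have hex : ∀ e : ℕ × ℕ, ∃ t, e ∈ N → (e.1 ≤ t ∧ t < e.2 ∧
      ∀ d ∈ C, d ≠ e → e.1 ≤ d.1 → d.1 ≤ t → t < d.2 → ¬ d.2 ≤ e.2) := by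
    intro e
    by_cases he : e ∈ N
    · have := (hN e he).2
      unfold ncCyc at this
      push Not at this
      obtain ⟨t, h1, h2, h3⟩ := this
      exact ⟨t, fun _ => ⟨h1, h2, fun d a b c e f => not_le.mpr (h3 d a b c e f)⟩⟩
    · exact ⟨0, fun h => absurd h he⟩
  choose τ hτ using hex
  -- key: a chord of C over `τ e` contains e
  have hkey : ∀ e ∈ N, ∀ d ∈ C, d ≠ e → d.1 ≤ τ e → τ e < d.2 →
      d.1 ≤ e.1 ∧ e.2 ≤ d.2 ∧ e.2 - e.1 < d.2 - d.1 := by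
    intro e he d hd hne h1 h2
    obtain ⟨t1, t2, t3⟩ := hτ e he
    have h3 := t3 d hd hne
    have h4 := hnc d hd e (hN e he).1 hne
    have h5 : ¬ (d.1 = e.1 ∧ d.2 = e.2) := fun h => hne (Prod.ext h.1 h.2)
    unfold ChordsCross at h4
    omega
  have hinj : Set.InjOn τ N := by
    intro e he d hd h
    by_contra hne
    have a1 := hkey e he d (hN d hd).1 (Ne.symm hne) (by rw [h]; exact (hτ d hd).1)
      (by rw [h]; exact (hτ d hd).2.1)
    have a2 := hkey d hd e (hN e he).1 hne (by rw [← h]; exact (hτ e he).1)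
      (by rw [← h]; exact (hτ e he).2.1)
    omega
  set T := N.image τ with hT
  have hTc : T.card = N.card := Finset.card_image_of_injOn hinj
  have hTs : T ⊆ Finset.range l := by
    intro t ht
    obtain ⟨e, he, rfl⟩ := Finset.mem_image.mp ht
    have := (hτ e he).2.1
    have := (hC e (hN e he).1).2.2
    simp; omega
  let F : ℕ → (G.ConnectedComponent → ℚ) →ₗ[ℚ] ℚ := fun v =>
    if h : v ∈ Finset.Icc 1 l then LinearMap.proj (G.connectedComponentMk ⟨v, h⟩) else 0
  let φ : (G.ConnectedComponent → ℚ) →ₗ[ℚ] ({t // t ∈ Finset.range l \ T} → ℚ) :=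
    LinearMap.pi (fun t => F (t.1 + 1) - F t.1)
  have hF0 : F 0 = 0 := by simp [F]
  have hFe : ∀ e ∈ C, F e.1 = F e.2 := by
    intro e he
    obtain ⟨h1, h2, h3⟩ := hC e he
    have m1 : e.1 ∈ Finset.Icc 1 l := by simp; omega
    have m2 : e.2 ∈ Finset.Icc 1 l := by simp; omega
    have hadj := hG ⟨e.1, m1⟩ ⟨e.2, m2⟩ he
    have := SimpleGraph.ConnectedComponent.sound hadj.reachable
    simp only [F, dif_pos m1, dif_pos m2, this]
  have hφ : Function.Injective φ := by
    rw [← LinearMap.ker_eq_bot, LinearMap.ker_eq_bot']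
    intro g hg
    have hfree : ∀ t < l, t ∉ T → F (t+1) g - F t g = 0 := by
      intro t ht htT
      have := congrFun hg ⟨t, by simp [ht, htT]⟩
      simpa [φ] using this
    have hτ0 : ∀ n, ∀ e ∈ N, e.2 - e.1 < n → F (τ e + 1) g - F (τ e) g = 0 := by
      intro n
      induction n with
      | zero => intro e _ h; omega
      | succ n ih =>
        intro e he hlen
        obtain ⟨t1, t2, t3⟩ := hτ e he
        have hch := hC e (hN e he).1
        have hsum : ∑ t ∈ Finset.Ico e.1 e.2, (F (t+1) g - F t g) = F e.2 g - F e.1 g :=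
          Finset.sum_Ico_sub (fun t => F t g) (by have := hch.2.1; omega)
        rw [hFe e (hN e he).1, sub_self, Finset.sum_eq_single (τ e)] at hsum
        · exact hsum
        · intro t ht hne
          rw [Finset.mem_Ico] at ht
          by_cases htT : t ∈ T
          · obtain ⟨d, hd, rfl⟩ := Finset.mem_image.mp htT
            have := hkey d hd e (hN e he).1 (by rintro rfl; exact hne rfl) ht.1 ht.2
            exact ih d hd (by omega)
          · exact hfree t (by have := hch.2.2; omega) htT
        · intro h; simp at h; omega
    have hall : ∀ t < l, F (t+1) g - F t g = 0 := by
      intro t ht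
      by_cases htT : t ∈ T
      · obtain ⟨d, hd, rfl⟩ := Finset.mem_image.mp htT
        exact hτ0 _ d hd (Nat.lt_succ_self _)
      · exact hfree t ht htT
    have hz : ∀ t ≤ l, F t g = 0 := by
      intro t
      induction t with
      | zero => intro _; rw [hF0]; rfl
      | succ t ih =>
        intro h
        have h1 := hall t (by omega)
        have h2 := ih (by omega)
        linarith
    funext c
    induction c using SimpleGraph.ConnectedComponent.ind with
    | _ v =>
      obtain ⟨v, hv⟩ := v
      have := hz v (Finset.mem_Icc.mp hv).2
      simpa only [F, dif_pos hv, LinearMap.proj_apply, Pi.zero_apply] using this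
  have hfin := LinearMap.finrank_le_finrank_of_injective hφ
  haveI : Fintype G.ConnectedComponent := Fintype.ofFinite _
  rw [Module.finrank_fintype_fun_eq_card, Module.finrank_fintype_fun_eq_card,
    Fintype.card_coe, Finset.card_sdiff_of_subset hTs, Finset.card_range, hTc] at hfin
  have := Finset.card_le_card hTs
  rw [Finset.card_range, hTc] at this
  rw [Nat.card_eq_fintype_card]
  omega

/-- Let `l ≥ 1` and let `C` be a noncrossing set of chords of the path `1, 2, …, l`.
Let `G_C` be the graph on `{1, …, l}` with edge set `C`, let `c` be its number of
connected components and `m` its number of isolated vertices.  Then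
`m ≥ |C| - l + c + 1`, i.e. the number of isolated vertices exceeds the cycle rank
of `G_C` by at least one. -/
theorem noncrossing_chords_isolated_vertices (l : ℕ) (hl : 1 ≤ l)
    (C : Finset (ℕ × ℕ))
    (hC : ∀ c ∈ C, IsChord l c)
    (hnc : ∀ c ∈ C, ∀ d ∈ C, c ≠ d → ¬ ChordsCross c d) :
    ∀ (G : SimpleGraph {i : ℕ // i ∈ Finset.Icc 1 l}),
      G = SimpleGraph.fromRel (fun u v : {i : ℕ // i ∈ Finset.Icc 1 l} => ((u : ℕ), (v : ℕ)) ∈ C) →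
      (C.card : ℤ) - (l : ℤ) + (Nat.card G.ConnectedComponent : ℤ) + 1 ≤
        (Set.ncard {v : {i : ℕ // i ∈ Finset.Icc 1 l} | ∀ w, ¬ G.Adj v w} : ℤ) := by
  classical
  intro G hG
  have hadj : ∀ u v : {i : ℕ // i ∈ Finset.Icc 1 l}, ((u : ℕ), (v : ℕ)) ∈ C → G.Adj u v := by
    intro u v h
    rw [hG, SimpleGraph.fromRel_adj]
    refine ⟨?_, Or.inl h⟩
    rintro rfl
    have := (hC _ h).2.1
    simp at this
  have h1 := nc_comp l C hC hnc G hadj (C.filter (fun e => ¬ ncCyc C e)) (by simp)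
  have h2 := nc_main C (fun c hc => (hC c hc).2.1) hnc (l + 1) 0 (l + 1) (by omega) (by omega)
  have h3 : ncZ C (ncCyc C) 0 (l + 1) = C.filter (fun e => ncCyc C e) := by
    ext x
    simp only [ncZ, Finset.mem_filter]
    constructor
    · rintro ⟨h, h', -⟩; exact ⟨h, h'⟩
    · rintro ⟨h, h'⟩
      have := (hC x h).2.2
      exact ⟨h, h', by omega, by omega⟩
  have h4 := Finset.card_filter_add_card_filter_not (s := C) (fun e => ncCyc C e)
  have h5 : (ncI C 0 (l + 1)).card ≤
      Set.ncard {v : {i : ℕ // i ∈ Finset.Icc 1 l} | ∀ w, ¬ G.Adj v w} := by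
    rw [← Set.ncard_coe_finset, ← Set.ncard_image_of_injective _ Subtype.val_injective]
    apply Set.ncard_le_ncard _ (Set.toFinite _)
    intro v hv
    simp only [ncI, Finset.coe_filter, Set.mem_setOf_eq, Finset.mem_Ioo] at hv
    obtain ⟨hv1, hv2⟩ := hv
    refine ⟨⟨v, by simp; omega⟩, ?_, rfl⟩
    intro w hw
    rw [hG, SimpleGraph.fromRel_adj] at hw
    rcases hw.2 with h | h
    · exact (hv2 _ h (by omega) (by have := (hC _ h).2.2; omega)).1 rfl
    · exact (hv2 _ h (by omega) (by have := (hC _ h).2.2; omega)).2 rfl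
  rw [h3] at h2
  omega
end

section
/- Let v_1,…,v_k ∈ ℝ² be points with strictly increasing x-coordinates and let Π be the x-monotone polygonal path through v_1,…,v_k. Let D be a set of closed segments, each with both endpoints among {v_1,…,v_k}, such that every segment of D lies below Π, any two distinct segments of D intersect only in common endpoints, and no segment of D contains any point v_i other than its own endpoints. Let v_k' be a point vertically below v_k (i.e., x(v_k') = x(v_k) and y(v_k') ≤ y(v_k)), let Π' be the x-monotone polygonal path through v_1,…,v_{k−1},v_k', and let D' be obtained from D by replacing each segment [v_i, v_k] ∈ D by [v_i, v_k']. Then any two distinct segments of D' intersect only in common endpoints, and every segment of D' lies below Π'. -/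
/-- The x-monotone polygonal path through the points `v 0, …, v (k-1)`:
the union of the closed segments `[v i, v (i+1)]`. -/
def pathSet {k : ℕ} (v : Fin k → ℝ × ℝ) : Set (ℝ × ℝ) :=
  ⋃ (i : Fin k) (h : i.1 + 1 < k), segment ℝ (v i) (v ⟨i.1 + 1, h⟩)

/-- A point `p` lies *below* the polygonal path through `v` if some point of the path
has the same x-coordinate as `p` and y-coordinate at least `y(p)`. -/
def BelowPath {k : ℕ} (v : Fin k → ℝ × ℝ) (p : ℝ × ℝ) : Prop :=
  ∃ p' ∈ pathSet v, p'.1 = p.1 ∧ p.2 ≤ p'.2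

/-- height at `x` of the line through `a` and `b` -/
noncomputable def lineY (a b : ℝ × ℝ) (x : ℝ) : ℝ :=
  a.2 + (b.2 - a.2) / (b.1 - a.1) * (x - a.1)

lemma lineY_left (a b : ℝ × ℝ) : lineY a b a.1 = a.2 := by simp [lineY]

lemma lineY_right (a b : ℝ × ℝ) (h : a.1 < b.1) : lineY a b b.1 = b.2 := by
  have : b.1 - a.1 ≠ 0 := by linarith
  unfold lineY; field_simp; ring

lemma lineY_comb (a b : ℝ × ℝ) (l s t : ℝ) :
    lineY a b (l * s + (1 - l) * t) = l * lineY a b s + (1 - l) * lineY a b t := by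
  unfold lineY; ring

lemma lineY_mono (a b b' : ℝ × ℝ) (h : a.1 < b.1) (h1 : b'.1 = b.1) (h2 : b'.2 ≤ b.2) (x : ℝ)
    (hx : a.1 ≤ x) : lineY a b' x ≤ lineY a b x := by
  unfold lineY
  rw [h1]
  have : (b'.2 - a.2) / (b.1 - a.1) ≤ (b.2 - a.2) / (b.1 - a.1) :=
    div_le_div_of_nonneg_right (by linarith) (by linarith)
  have := mul_le_mul_of_nonneg_right this (sub_nonneg.2 hx)
  linarith

lemma exists_comb (s t x : ℝ) (h : s < t) (h1 : s ≤ x) (h2 : x ≤ t) :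
    ∃ l : ℝ, 0 ≤ l ∧ l ≤ 1 ∧ x = l * s + (1 - l) * t := by
  have h0 : 0 < t - s := by linarith
  refine ⟨(t - x) / (t - s), div_nonneg (by linarith) h0.le, ?_, ?_⟩
  · rw [div_le_one h0]; linarith
  · field_simp; ring

lemma mem_seg (a b p : ℝ × ℝ) (h : a.1 < b.1) :
    p ∈ segment ℝ a b ↔ a.1 ≤ p.1 ∧ p.1 ≤ b.1 ∧ p.2 = lineY a b p.1 := by
  constructor
  · rintro ⟨l, m, hl, hm, hlm, rfl⟩
    have hm' : m = 1 - l := by linarith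
    subst hm'
    have := lineY_comb a b l a.1 b.1
    rw [lineY_left, lineY_right a b h] at this
    simp only [Prod.fst_add, Prod.snd_add, Prod.smul_fst, Prod.smul_snd, smul_eq_mul]
    refine ⟨by nlinarith, by nlinarith, this.symm⟩
  · rintro ⟨h1, h2, h3⟩
    obtain ⟨l, hl, hl1, hx⟩ := exists_comb a.1 b.1 p.1 h h1 h2
    refine ⟨l, 1 - l, hl, by linarith, by ring, ?_⟩
    ext
    · simp [hx]
    · rw [h3, hx, lineY_comb, lineY_left, lineY_right a b h]; simp

lemma seg_left {a b p : ℝ × ℝ} (h : a.1 < b.1) (hp : p ∈ segment ℝ a b) (hx : p.1 = a.1) :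
    p = a := by
  obtain ⟨-, -, h3⟩ := (mem_seg a b p h).1 hp
  rw [hx, lineY_left] at h3
  exact Prod.ext hx h3

lemma seg_right {a b p : ℝ × ℝ} (h : a.1 < b.1) (hp : p ∈ segment ℝ a b) (hx : p.1 = b.1) :
    p = b := by
  obtain ⟨-, -, h3⟩ := (mem_seg a b p h).1 hp
  rw [hx, lineY_right a b h] at h3
  exact Prod.ext hx h3

lemma below_iff {k : ℕ} (v : Fin k → ℝ × ℝ) (p : ℝ × ℝ) :
    BelowPath v p ↔ ∃ (i : Fin k) (h : i.1 + 1 < k),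
      ∃ p' ∈ segment ℝ (v i) (v ⟨i.1 + 1, h⟩), p'.1 = p.1 ∧ p.2 ≤ p'.2 := by
  unfold BelowPath pathSet
  simp only [Set.mem_iUnion]
  constructor
  · rintro ⟨p', ⟨i, h, hp⟩, h2⟩; exact ⟨i, h, p', hp, h2⟩
  · rintro ⟨i, h, p', hp, h2⟩; exact ⟨p', ⟨i, h, hp⟩, h2⟩

lemma below_vertex {k : ℕ} (v : Fin k → ℝ × ℝ) (hmono : StrictMono (fun i => (v i).1))
    (p : ℝ × ℝ) (hp : BelowPath v p) (m : Fin k) (hm : p.1 = (v m).1) : p.2 ≤ (v m).2 := by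
  obtain ⟨i, h, p', hs, hx, hy⟩ := (below_iff v p).1 hp
  have hlt : (v i).1 < (v ⟨i.1 + 1, h⟩).1 := hmono (show i < ⟨i.1 + 1, h⟩ from Nat.lt_succ_self i.1)
  obtain ⟨h1, h2, h3⟩ := (mem_seg _ _ _ hlt).1 hs
  rw [hx, hm] at h1 h2
  have h1' : i ≤ m := hmono.le_iff_le.1 h1
  have h2' : m ≤ ⟨i.1 + 1, h⟩ := hmono.le_iff_le.1 h2
  have h1'' : i.1 ≤ m.1 := h1'
  have h2'' : m.1 ≤ i.1 + 1 := h2'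
  rcases Nat.lt_or_ge i.1 m.1 with hc | hc
  · have : m = ⟨i.1 + 1, h⟩ := Fin.ext (by simp; omega)
    rw [← this] at hs hlt
    have := seg_right hlt hs (hx.trans hm)
    rwa [this] at hy
  · have : m = i := Fin.ext (by omega)
    subst this
    have := seg_left hlt hs (hx.trans hm)
    rwa [this] at hy

lemma chord_vertex {k : ℕ} (v : Fin k → ℝ × ℝ) (hmono : StrictMono (fun i => (v i).1))
    (a b : Fin k) (hab : a < b) (hb : ∀ p ∈ segment ℝ (v a) (v b), BelowPath v p)
    (m : Fin k) (ham : a ≤ m) (hmb : m ≤ b) :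
    lineY (v a) (v b) (v m).1 ≤ (v m).2 := by
  have hlt : (v a).1 < (v b).1 := hmono hab
  exact below_vertex v hmono ((v m).1, lineY (v a) (v b) (v m).1)
    (hb _ ((mem_seg _ _ _ hlt).2 ⟨hmono.le_iff_le.2 ham, hmono.le_iff_le.2 hmb, rfl⟩)) m rfl

lemma chord_vertex_lt {k : ℕ} (v : Fin k → ℝ × ℝ) (hmono : StrictMono (fun i => (v i).1))
    (a b : Fin k) (hab : a < b) (hb : ∀ p ∈ segment ℝ (v a) (v b), BelowPath v p)
    (hv : ∀ m : Fin k, v m ∈ segment ℝ (v a) (v b) → m = a ∨ m = b)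
    (m : Fin k) (ham : a < m) (hmb : m < b) :
    lineY (v a) (v b) (v m).1 < (v m).2 := by
  have hlt : (v a).1 < (v b).1 := hmono hab
  refine lt_of_le_of_ne (chord_vertex v hmono a b hab hb m ham.le hmb.le) fun he => ?_
  rcases hv m ((mem_seg _ _ _ hlt).2 ⟨(hmono ham).le, (hmono hmb).le, he.symm⟩) with h | h
  · exact ham.ne' h
  · exact hmb.ne h

/-- an unmoved chord `[v a, v b]` against the moved chord `[v i, q]` -/
lemma case_one {k : ℕ} (v : Fin k → ℝ × ℝ) (hmono : StrictMono (fun i => (v i).1))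
    (i L a b : Fin k) (hiL : i < L) (hab : a < b) (hbL : b < L)
    (hbe : ∀ p ∈ segment ℝ (v i) (v L), BelowPath v p)
    (hbf : ∀ p ∈ segment ℝ (v a) (v b), BelowPath v p)
    (hve : ∀ m : Fin k, v m ∈ segment ℝ (v i) (v L) → m = i ∨ m = L)
    (hvf : ∀ m : Fin k, v m ∈ segment ℝ (v a) (v b) → m = a ∨ m = b)
    (hc : ∀ p ∈ segment ℝ (v i) (v L), p ∈ segment ℝ (v a) (v b) →
        ∃ w : Fin k, (w = i ∨ w = L) ∧ (w = a ∨ w = b) ∧ p = v w)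
    (q : ℝ × ℝ) (hq1 : q.1 = (v L).1) (hq2 : q.2 ≤ (v L).2) (p : ℝ × ℝ)
    (hp1 : p ∈ segment ℝ (v i) q) (hp2 : p ∈ segment ℝ (v a) (v b)) :
    (i = a ∨ i = b) ∧ p = v i := by
  have hx : ∀ {s t : Fin k}, s < t → (v s).1 < (v t).1 := fun h => hmono h
  have hiq : (v i).1 < q.1 := by rw [hq1]; exact hx hiL
  obtain ⟨e1, e2, e3⟩ := (mem_seg _ _ _ hiq).1 hp1
  obtain ⟨f1, f2, f3⟩ := (mem_seg _ _ _ (hx hab)).1 hp2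
  have hle := lineY_mono (v i) (v L) q (hx hiL) hq1 hq2 p.1 e1
  rcases lt_trichotomy b i with h | h | h
  · have := hx h; linarith
  · subst h
    exact ⟨Or.inr rfl, seg_left hiq hp1 (le_antisymm f2 e1)⟩
  have hb := chord_vertex_lt v hmono i L hiL hbe hve b h hbL
  have Fb := lineY_right (v a) (v b) (hx hab)
  rcases lt_trichotomy a i with h' | h' | h'
  · exfalso
    have hi := chord_vertex_lt v hmono a b hab hbf hvf i h' h
    have Ei := lineY_left (v i) (v L)
    obtain ⟨A, hA⟩ : ∃ A, A = (v i).2 - lineY (v a) (v b) (v i).1 := ⟨_, rfl⟩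
    obtain ⟨B, hB⟩ : ∃ B, B = (v b).2 - lineY (v i) (v L) (v b).1 := ⟨_, rfl⟩
    have hA0 : 0 < A := by linarith
    have hB0 : 0 < B := by linarith
    obtain ⟨l, hl⟩ : ∃ l, l = B / (A + B) := ⟨_, rfl⟩
    have hl0 : 0 ≤ l := by rw [hl]; positivity
    have hl1 : l ≤ 1 := by rw [hl, div_le_one (by linarith)]; linarith
    have hlA : l * A = (1 - l) * B := by rw [hl]; field_simp; ring
    have hxib := hx h
    have hxbL := hx hbL
    have hxai := hx h'
    obtain ⟨x, hxd⟩ : ∃ x, x = l * (v i).1 + (1 - l) * (v b).1 := ⟨_, rfl⟩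
    have hx1 : (v i).1 ≤ x := by nlinarith
    have hx2 : x ≤ (v b).1 := by nlinarith
    have heq : lineY (v i) (v L) x = lineY (v a) (v b) x := by
      rw [hxd, lineY_comb, lineY_comb, Ei, Fb]
      rw [hA, hB] at hlA
      linarith
    obtain ⟨w, h1, h2, -⟩ := hc (x, lineY (v i) (v L) x)
      ((mem_seg _ _ _ (hx hiL)).2 ⟨hx1, by simp only; linarith, rfl⟩)
      ((mem_seg _ _ _ (hx hab)).2 ⟨by simp only; linarith, hx2, heq⟩)
    rcases h1 with rfl | rfl <;> rcases h2 with rfl | rfl <;> order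
  · subst h'
    refine ⟨Or.inl rfl, ?_⟩
    obtain ⟨l, hl0, hl1, hl⟩ := exists_comb _ _ _ (hx h) e1 f2
    have h1 : l = 1 := by
      by_contra hne
      have : 0 < 1 - l := sub_pos.2 (lt_of_le_of_ne hl1 hne)
      rw [← e3, f3, hl, lineY_comb, lineY_comb, lineY_left, lineY_left, Fb] at hle
      nlinarith
    exact seg_left hiq hp1 (by rw [hl, h1]; ring)
  · exfalso
    have ha := chord_vertex_lt v hmono i L hiL hbe hve a h' (hab.trans hbL)
    obtain ⟨l, hl0, hl1, hl⟩ := exists_comb _ _ _ (hx hab) f1 f2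
    rw [← e3, f3, hl, lineY_comb, lineY_comb, lineY_left, Fb] at hle
    rcases hl0.eq_or_lt with h0 | h0
    · subst h0; linarith
    · have := mul_pos h0 (sub_pos.2 ha)
      have := mul_nonneg (sub_nonneg.2 hl1) (sub_pos.2 hb).le
      linarith

/-- two moved chords -/
lemma case_two {k : ℕ} (v : Fin k → ℝ × ℝ) (hmono : StrictMono (fun i => (v i).1))
    (i L j : Fin k) (hij : i < j) (hjL : j < L)
    (hbe : ∀ p ∈ segment ℝ (v i) (v L), BelowPath v p)
    (hve : ∀ m : Fin k, v m ∈ segment ℝ (v i) (v L) → m = i ∨ m = L)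
    (q : ℝ × ℝ) (hq1 : q.1 = (v L).1) (hq2 : q.2 ≤ (v L).2) (p : ℝ × ℝ)
    (hp1 : p ∈ segment ℝ (v i) q) (hp2 : p ∈ segment ℝ (v j) q) : p = q := by
  have hx : ∀ {s t : Fin k}, s < t → (v s).1 < (v t).1 := fun h => hmono h
  have hiq : (v i).1 < q.1 := by rw [hq1]; exact hx (hij.trans hjL)
  have hjq : (v j).1 < q.1 := by rw [hq1]; exact hx hjL
  obtain ⟨e1, e2, e3⟩ := (mem_seg _ _ _ hiq).1 hp1
  obtain ⟨f1, f2, f3⟩ := (mem_seg _ _ _ hjq).1 hp2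
  have hle := lineY_mono (v i) (v L) q (hx (hij.trans hjL)) hq1 hq2 (v j).1 (hx hij).le
  have hlt := chord_vertex_lt v hmono i L (hij.trans hjL) hbe hve j hij hjL
  obtain ⟨l, hl0, hl1, hl⟩ := exists_comb _ _ _ hjq f1 f2
  have h0 : l = 0 := by
    by_contra hne
    have : 0 < l := lt_of_le_of_ne hl0 (Ne.symm hne)
    rw [f3, hl, lineY_comb, lineY_comb, lineY_left, lineY_right _ _ hiq, lineY_right _ _ hjq] at e3
    nlinarith
  exact seg_right hiq hp1 (by rw [hl, h0]; ring)

/-- Let `Π` be the x-monotone polygonal path through `v 0, …, v (k-1)` and let `D` be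
a set of segments with endpoints among the `v i`, all lying below `Π`, pairwise
intersecting only in common endpoints, and containing no vertex `v m` other than
their own endpoints.  Move the last vertex vertically down to `vk'`.  Then the
resulting segments `D'` pairwise intersect only in common endpoints and all lie
below the resulting path `Π'`. -/
theorem chords_move_last_vertex_down (k : ℕ) (hk : 2 ≤ k) (v : Fin k → ℝ × ℝ)
    (hmono : StrictMono (fun i => (v i).1))
    (D : Set (Fin k × Fin k)) (hD : ∀ e ∈ D, e.1 < e.2)
    (hbelow : ∀ e ∈ D, ∀ p ∈ segment ℝ (v e.1) (v e.2), BelowPath v p)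
    (hcross : ∀ e ∈ D, ∀ f ∈ D, ({e.1, e.2} : Set (Fin k)) ≠ ({f.1, f.2} : Set (Fin k)) →
      ∀ p ∈ segment ℝ (v e.1) (v e.2), p ∈ segment ℝ (v f.1) (v f.2) →
        ∃ w : Fin k, (w = e.1 ∨ w = e.2) ∧ (w = f.1 ∨ w = f.2) ∧ p = v w)
    (hvert : ∀ e ∈ D, ∀ m : Fin k, v m ∈ segment ℝ (v e.1) (v e.2) → m = e.1 ∨ m = e.2)
    (vk' : ℝ × ℝ)
    (hx : vk'.1 = (v ⟨k - 1, by omega⟩).1) (hy : vk'.2 ≤ (v ⟨k - 1, by omega⟩).2) :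
    ∀ (v' : Fin k → ℝ × ℝ), v' = Function.update v ⟨k - 1, by omega⟩ vk' →
      (∀ e ∈ D, ∀ f ∈ D, ({e.1, e.2} : Set (Fin k)) ≠ ({f.1, f.2} : Set (Fin k)) →
        ∀ p ∈ segment ℝ (v' e.1) (v' e.2), p ∈ segment ℝ (v' f.1) (v' f.2) →
          ∃ w : Fin k, (w = e.1 ∨ w = e.2) ∧ (w = f.1 ∨ w = f.2) ∧ p = v' w) ∧
      (∀ e ∈ D, ∀ p ∈ segment ℝ (v' e.1) (v' e.2), BelowPath v' p) := by
  intro v' hv'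
  obtain ⟨L, hL⟩ : ∃ L : Fin k, L = ⟨k - 1, by omega⟩ := ⟨_, rfl⟩
  rw [← hL] at hx hy hv'
  have hLmax : ∀ m : Fin k, m ≤ L := fun m => by rw [hL, Fin.le_def]; simp; omega
  have hvL : v' L = vk' := by rw [hv']; simp
  have hvn : ∀ m, m < L → v' m = v m := fun m hm => by
    rw [hv', Function.update_of_ne hm.ne]
  have hlt1 : ∀ e ∈ D, e.1 < L := fun e he => lt_of_lt_of_le (hD e he) (hLmax _)
  clear hv'
  have hX : ∀ {s t : Fin k}, s < t → (v s).1 < (v t).1 := fun h => hmono h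
  constructor
  · intro e he f hf hne p hp1 hp2
    have he1 := hlt1 e he
    have hf1 := hlt1 f hf
    rw [hvn _ he1] at hp1
    rw [hvn _ hf1] at hp2
    rcases (hLmax e.2).eq_or_lt with h1 | h1 <;> rcases (hLmax f.2).eq_or_lt with h2 | h2
    · rw [h1, hvL] at hp1
      rw [h2, hvL] at hp2
      refine ⟨L, Or.inr h1.symm, Or.inr h2.symm, ?_⟩
      rw [hvL]
      rcases lt_trichotomy e.1 f.1 with h | h | h
      · exact case_two v hmono e.1 L f.1 h hf1 (h1 ▸ hbelow e he) (h1 ▸ hvert e he) vk' hx hy p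
          hp1 hp2
      · exact absurd (by rw [h, h1, h2]) hne
      · exact case_two v hmono f.1 L e.1 h he1 (h2 ▸ hbelow f hf) (h2 ▸ hvert f hf) vk' hx hy p
          hp2 hp1
    · rw [h1, hvL] at hp1
      rw [hvn _ h2] at hp2
      obtain ⟨r1, r2⟩ := case_one v hmono e.1 L f.1 f.2 he1 (hD f hf) h2 (h1 ▸ hbelow e he)
        (hbelow f hf) (h1 ▸ hvert e he) (hvert f hf) (h1 ▸ hcross e he f hf hne) vk' hx hy p hp1 hp2
      exact ⟨e.1, Or.inl rfl, r1, by rw [hvn _ he1]; exact r2⟩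
    · rw [h2, hvL] at hp2
      rw [hvn _ h1] at hp1
      obtain ⟨r1, r2⟩ := case_one v hmono f.1 L e.1 e.2 hf1 (hD e he) h1 (h2 ▸ hbelow f hf)
        (hbelow e he) (h2 ▸ hvert f hf) (hvert e he) (h2 ▸ hcross f hf e he hne.symm) vk' hx hy p
        hp2 hp1
      exact ⟨f.1, r1, Or.inl rfl, by rw [hvn _ hf1]; exact r2⟩
    · rw [hvn _ h1] at hp1
      rw [hvn _ h2] at hp2
      obtain ⟨w, w1, w2, w3⟩ := hcross e he f hf hne p hp1 hp2
      refine ⟨w, w1, w2, ?_⟩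
      rw [hvn, w3]
      rcases w1 with rfl | rfl
      · exact he1
      · exact h1
  · intro e he p hp
    have he1 := hlt1 e he
    rw [hvn _ he1] at hp
    rw [below_iff]
    rcases (hLmax e.2).eq_or_lt with h1 | h1
    · rw [h1, hvL] at hp
      have hiq : (v e.1).1 < vk'.1 := by rw [hx]; exact hX he1
      obtain ⟨e1, e2, e3⟩ := (mem_seg _ _ _ hiq).1 hp
      have hle := lineY_mono (v e.1) (v L) vk' (hX he1) hx hy p.1 e1
      have hbe : ∀ p ∈ segment ℝ (v e.1) (v L), BelowPath v p := h1 ▸ hbelow e he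
      obtain ⟨j, hj, p', hs, hpx, hpy⟩ := (below_iff _ _).1 (hbe (p.1, lineY (v e.1) (v L) p.1)
        ((mem_seg _ _ _ (hX he1)).2 ⟨e1, by rw [← hx]; exact e2, rfl⟩))
      simp only at hpx hpy
      have hjj : j < (⟨j.1 + 1, hj⟩ : Fin k) := Nat.lt_succ_self j.1
      have hjL : j < L := lt_of_lt_of_le hjj (hLmax _)
      refine ⟨j, hj, ?_⟩
      rw [hvn _ hjL]
      rcases (hLmax ⟨j.1 + 1, hj⟩).eq_or_lt with h2 | h2
      · rw [h2] at hs
        rw [h2, hvL]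
        have hjq : (v j).1 < vk'.1 := by rw [hx]; exact hX hjL
        obtain ⟨g1, g2, g3⟩ := (mem_seg _ _ _ (hX hjL)).1 hs
        rw [hpx] at g1
        refine ⟨(p.1, lineY (v j) vk' p.1), (mem_seg _ _ _ hjq).2 ⟨g1, e2, rfl⟩, rfl, ?_⟩
        have hij : e.1 ≤ j := by
          have : e.1.1 < L.1 := he1
          have h3 : j.1 + 1 = L.1 := congrArg Fin.val h2
          rw [Fin.le_def]; omega
        have hb := chord_vertex v hmono e.1 L he1 hbe j hij hjL.le
        have hb' := lineY_mono (v e.1) (v L) vk' (hX he1) hx hy (v j).1 (hmono.le_iff_le.2 hij)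
        obtain ⟨l, hl0, hl1, hl⟩ := exists_comb _ _ _ hjq g1 e2
        simp only
        rw [e3, hl, lineY_comb, lineY_comb, lineY_left, lineY_right _ _ hiq, lineY_right _ _ hjq]
        have := mul_le_mul_of_nonneg_left (hb'.trans hb) hl0
        linarith
      · rw [hvn _ h2]
        exact ⟨p', hs, hpx, by rw [e3]; exact hle.trans hpy⟩
    · rw [hvn _ h1] at hp
      obtain ⟨e1, e2, e3⟩ := (mem_seg _ _ _ (hX (hD e he))).1 hp
      obtain ⟨j, hj, p', hs, hpx, hpy⟩ := (below_iff _ _).1 (hbelow e he p hp)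
      have hjj : j < (⟨j.1 + 1, hj⟩ : Fin k) := Nat.lt_succ_self j.1
      have hjL : j < L := lt_of_lt_of_le hjj (hLmax _)
      refine ⟨j, hj, p', ?_, hpx, hpy⟩
      rw [hvn _ hjL]
      rcases (hLmax ⟨j.1 + 1, hj⟩).eq_or_lt with h2 | h2
      · obtain ⟨g1, g2, g3⟩ := (mem_seg _ _ _ (hX hjj)).1 hs
        have hbj : e.2 ≤ j := by
          have : e.2.1 < L.1 := h1
          have h3 : j.1 + 1 = L.1 := congrArg Fin.val h2
          rw [Fin.le_def]; omega
        have : (v e.2).1 ≤ (v j).1 := hmono.le_iff_le.2 hbj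
        rw [seg_left (hX hjj) hs (by linarith)]
        exact left_mem_segment ℝ _ _
      · rwa [hvn _ h2]
end

section
/- Let v_1,…,v_k ∈ ℝ² be points with strictly increasing x-coordinates and let Π be the x-monotone polygonal path through v_1,…,v_k. Let C be a noncrossing set of chords of the path 1,2,…,k, and let V* ⊆ {1,…,k} be a vertex cover of C (every chord in C has at least one of its two indices in V*). Then there exist points v_1',…,v_k' with v_i' = v_i for every i ∉ V*, and x(v_i') = x(v_i) and y(v_i') ≤ y(v_i) for every i ∈ V*, such that: the path v_1',…,v_k' is x-monotone; for every chord {i,j} ∈ C the segment [v_i', v_j'] lies below the x-monotone polygonal path Π' through v_1',…,v_k'; and the straight-line drawing of the graph on {1,…,k} whose edges are the path edges {i,i+1} together with the chords in C, sending i to v_i', is plane (any two of the drawn segments intersect only in common endpoints, and no drawn segment contains a point v_i' other than its own endpoints). -/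
lemma mem_seg_iff (a b p : ℝ × ℝ) (h : a.1 < b.1) : p ∈ segment ℝ a b ↔
    a.1 ≤ p.1 ∧ p.1 ≤ b.1 ∧
      (b.1 - a.1) * p.2 = (b.1 - p.1) * a.2 + (p.1 - a.1) * b.2 := by
  have hd : 0 < b.1 - a.1 := by linarith
  constructor
  · rintro ⟨s, t, hs, ht, hst, rfl⟩
    have hs' : s = 1 - t := by linarith
    subst hs'
    simp only [Prod.fst_add, Prod.snd_add, Prod.smul_fst, Prod.smul_snd, smul_eq_mul]
    refine ⟨by nlinarith, by nlinarith, by ring⟩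
  · rintro ⟨h1, h2, h3⟩
    refine ⟨(b.1 - p.1) / (b.1 - a.1), (p.1 - a.1) / (b.1 - a.1),
      div_nonneg (by linarith) hd.le, div_nonneg (by linarith) hd.le, ?_, ?_⟩
    · rw [← add_div, div_eq_one_iff_eq hd.ne']; ring
    · ext
      · simp only [Prod.fst_add, Prod.smul_fst, smul_eq_mul]
        field_simp; ring
      · simp only [Prod.snd_add, Prod.smul_snd, smul_eq_mul]
        field_simp; linarith

/-- signed (scaled) height of `q` above the line through `a`, `b` -/
def hgt (a b q : ℝ × ℝ) : ℝ := (b.1 - a.1) * q.2 - (b.1 - q.1) * a.2 - (q.1 - a.1) * b.2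

lemma hgt_left (a b : ℝ × ℝ) : hgt a b a = 0 := by unfold hgt; ring
lemma hgt_right (a b : ℝ × ℝ) : hgt a b b = 0 := by unfold hgt; ring

lemma hgt_affine (a b c d p : ℝ × ℝ)
    (h : (d.1 - c.1) * p.2 = (d.1 - p.1) * c.2 + (p.1 - c.1) * d.2) :
    (d.1 - c.1) * hgt a b p = (d.1 - p.1) * hgt a b c + (p.1 - c.1) * hgt a b d := by
  unfold hgt
  linear_combination (b.1 - a.1) * h

lemma nested_inter {k : ℕ} (v : Fin k → ℝ × ℝ) (hmono : StrictMono (fun i => (v i).1))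
    (i j a b : Fin k) (hia : i ≤ a) (hab : a < b) (hbj : b ≤ j) (hne : i ≠ a ∨ j ≠ b)
    (H : ∀ m, i < m → m < j → 0 < hgt (v i) (v j) (v m)) (p : ℝ × ℝ)
    (h1 : p ∈ segment ℝ (v a) (v b)) (h2 : p ∈ segment ℝ (v i) (v j)) :
    ∃ w, (w = a ∨ w = b) ∧ (w = i ∨ w = j) ∧ p = v w := by
  have xab : (v a).1 < (v b).1 := hmono hab
  have xij : (v i).1 < (v j).1 := hmono (by order)
  rw [mem_seg_iff _ _ _ xab] at h1
  rw [mem_seg_iff _ _ _ xij] at h2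
  obtain ⟨p1, p2, p3⟩ := h1
  have gp : hgt (v i) (v j) p = 0 := by unfold hgt; linarith [h2.2.2]
  have key := hgt_affine (v i) (v j) _ _ _ p3
  rw [gp, mul_zero] at key
  have ga : 0 ≤ hgt (v i) (v j) (v a) := by
    rcases eq_or_lt_of_le hia with h | h
    · rw [← h, hgt_left]
    · exact (H a h (by order)).le
  have gb : 0 ≤ hgt (v i) (v j) (v b) := by
    rcases eq_or_lt_of_le hbj with h | h
    · rw [h, hgt_right]
    · exact (H b (by order) h).le
  have t1 : 0 ≤ ((v b).1 - p.1) * hgt (v i) (v j) (v a) := mul_nonneg (by linarith) ga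
  have t2 : 0 ≤ (p.1 - (v a).1) * hgt (v i) (v j) (v b) := mul_nonneg (by linarith) gb
  have z1 : ((v b).1 - p.1) * hgt (v i) (v j) (v a) = 0 := by linarith
  have z2 : (p.1 - (v a).1) * hgt (v i) (v j) (v b) = 0 := by linarith
  have hd : (v b).1 - (v a).1 ≠ 0 := by linarith
  rcases eq_or_lt_of_le hia with h | h
  · have hb : b < j := by
      rcases eq_or_lt_of_le hbj with h' | h'
      · exact absurd h'.symm (by tauto)
      · exact h'
    have := (H b (by order) hb).ne'
    have e : p.1 = (v a).1 := by
      rcases mul_eq_zero.1 z2 with h | h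
      · linarith
      · contradiction
    refine ⟨a, Or.inl rfl, Or.inl h.symm, Prod.ext e ?_⟩
    rw [e] at p3
    apply mul_left_cancel₀ hd
    linarith
  · have := (H a h (by order)).ne'
    have e : p.1 = (v b).1 := by
      rcases mul_eq_zero.1 z1 with h | h
      · linarith
      · contradiction
    have hb : b = j := by
      rcases eq_or_lt_of_le hbj with h' | h'
      · exact h'
      · have := (H b (by order) h').ne'
        rcases mul_eq_zero.1 z2 with h | h
        · exact absurd h (by rw [e]; exact hd)
        · contradiction
    refine ⟨b, Or.inr rfl, Or.inr hb, Prod.ext e ?_⟩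
    rw [e] at p3
    apply mul_left_cancel₀ hd
    linarith

lemma disj_inter {k : ℕ} (v : Fin k → ℝ × ℝ) (hmono : StrictMono (fun i => (v i).1))
    (i j a b : Fin k) (hij : i < j) (hja : j ≤ a) (hab : a < b) (p : ℝ × ℝ)
    (h1 : p ∈ segment ℝ (v i) (v j)) (h2 : p ∈ segment ℝ (v a) (v b)) :
    j = a ∧ p = v j := by
  have xab : (v a).1 < (v b).1 := hmono hab
  have xij : (v i).1 < (v j).1 := hmono hij
  have xja : (v j).1 ≤ (v a).1 := hmono.monotone hja
  rw [mem_seg_iff _ _ _ xij] at h1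
  rw [mem_seg_iff _ _ _ xab] at h2
  obtain ⟨p1, p2, p3⟩ := h1
  obtain ⟨q1, q2, q3⟩ := h2
  have e : p.1 = (v j).1 := by linarith
  refine ⟨hmono.injective (by show (v j).1 = (v a).1; linarith), Prod.ext e ?_⟩
  have hd : (v j).1 - (v i).1 ≠ 0 := by linarith
  rw [e] at p3
  apply mul_left_cancel₀ hd
  linarith

lemma find_step (x : ℕ → ℝ) (t : ℝ) (i n : ℕ) (h0 : x i ≤ t) (h1 : t ≤ x (i + n + 1)) :
    ∃ m, i ≤ m ∧ m ≤ i + n ∧ x m ≤ t ∧ t ≤ x (m + 1) := by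
  induction n with
  | zero => exact ⟨i, le_rfl, by omega, h0, h1⟩
  | succ n ih =>
    by_cases h : t ≤ x (i + n + 1)
    · obtain ⟨m, a, b, c⟩ := ih h
      exact ⟨m, a, by omega, c⟩
    · exact ⟨i + n + 1, by omega, by omega, by linarith, h1⟩

lemma below_chord {k : ℕ} (v : Fin k → ℝ × ℝ) (hmono : StrictMono (fun i => (v i).1))
    (i j : Fin k) (hij : i < j)
    (H : ∀ m, i < m → m < j → 0 < hgt (v i) (v j) (v m)) (p : ℝ × ℝ)
    (h2 : p ∈ segment ℝ (v i) (v j)) : BelowPath v p := by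
  have xij : (v i).1 < (v j).1 := hmono hij
  rw [mem_seg_iff _ _ _ xij] at h2
  obtain ⟨p1, p2, p3⟩ := h2
  have hij' : i.1 < j.1 := hij
  obtain ⟨n, hn⟩ : ∃ n, j.1 = i.1 + n + 1 := ⟨j.1 - i.1 - 1, by omega⟩
  obtain ⟨m, m1, m2, m3, m4⟩ := find_step
    (fun a => if h : a < k then (v ⟨a, h⟩).1 else 0) p.1 i.1 n
    (by simpa using p1) (by
      rw [← hn]; simpa using p2)
  have hj := j.2
  have hm : m < k := by omega
  have hm1 : m + 1 < k := by omega
  simp only [hm, hm1, dif_pos] at m3 m4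
  have G : ∀ q, i ≤ q → q ≤ j → 0 ≤ hgt (v i) (v j) (v q) := by
    intro q h h'
    rcases eq_or_lt_of_le h with h | h
    · rw [← h, hgt_left]
    rcases eq_or_lt_of_le h' with h' | h'
    · rw [h', hgt_right]
    exact (H q h h').le
  have ga := G ⟨m, hm⟩ (by rw [Fin.le_def]; exact m1) (by rw [Fin.le_def]; simp only; omega)
  have gb := G ⟨m + 1, hm1⟩ (by rw [Fin.le_def]; simp only; omega)
    (by rw [Fin.le_def]; simp only; omega)
  have xab : (v ⟨m, hm⟩).1 < (v ⟨m + 1, hm1⟩).1 := hmono (by rw [Fin.lt_def]; simp)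
  set a := v ⟨m, hm⟩ with ha
  set b := v ⟨m + 1, hm1⟩ with hb
  have hd : 0 < b.1 - a.1 := by linarith
  obtain ⟨y, hy⟩ : ∃ y, (b.1 - a.1) * y = (b.1 - p.1) * a.2 + (p.1 - a.1) * b.2 :=
    ⟨((b.1 - p.1) * a.2 + (p.1 - a.1) * b.2) / (b.1 - a.1), by field_simp⟩
  refine ⟨(p.1, y), ?_, rfl, ?_⟩
  · unfold pathSet
    refine Set.mem_iUnion₂.2 ⟨⟨m, hm⟩, hm1, ?_⟩
    exact (mem_seg_iff a b _ xab).2 ⟨m3, m4, hy⟩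
  · have key := hgt_affine (v i) (v j) a b (p.1, y) hy
    have t1 : 0 ≤ (b.1 - p.1) * hgt (v i) (v j) a := mul_nonneg (by linarith) ga
    have t2 : 0 ≤ (p.1 - a.1) * hgt (v i) (v j) b := mul_nonneg (by linarith) gb
    have g : 0 ≤ hgt (v i) (v j) (p.1, y) := by
      simp only at key
      exact nonneg_of_mul_nonneg_right (by linarith) hd
    unfold hgt at g
    simp only at g ⊢
    have : 0 ≤ ((v j).1 - (v i).1) * (y - p.2) := by linarith
    have := nonneg_of_mul_nonneg_right this (by linarith)
    linarith

lemma num_ineq (xi xj xm yi yj ym T S si sj sm : ℝ) (h1 : xi < xm) (h2 : xm < xj)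
    (hT : (|xj - xi| + |(xj - xm) * yi + (xm - xi) * yj - (xj - xi) * ym|) / |xj - xm| < T)
    (hS : 1 ≤ S) (hm : sm ≤ S) (hi : T * S ≤ si) (hj : 0 ≤ sj) :
    0 < (xj - xi) * (ym - sm) - (xj - xm) * (yi - si) - (xm - xi) * (yj - sj) := by
  have d1 : 0 < xj - xm := by linarith
  have d2 : 0 < xj - xi := by linarith
  have d3 : 0 < xm - xi := by linarith
  rw [abs_of_pos d1, abs_of_pos d2, div_lt_iff₀ d1] at hT
  have hA := le_abs_self ((xj - xm) * yi + (xm - xi) * yj - (xj - xi) * ym)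
  have hA0 := abs_nonneg ((xj - xm) * yi + (xm - xi) * yj - (xj - xi) * ym)
  set A := |(xj - xm) * yi + (xm - xi) * yj - (xj - xi) * ym|
  have e1 : (xj - xi + A) * S < T * (xj - xm) * S := by
    apply mul_lt_mul_of_pos_right hT; linarith
  have e2 : A ≤ A * S := le_mul_of_one_le_right hA0 hS
  have e3 := mul_le_mul_of_nonneg_left hi d1.le
  have e4 := mul_le_mul_of_nonneg_left hm d2.le
  have e5 := mul_nonneg d3.le hj
  nlinarith

lemma heights (k : ℕ) (v : Fin k → ℝ × ℝ)
    (hmono : StrictMono (fun i => (v i).1))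
    (C : Set (Fin k × Fin k)) (hC : ∀ c ∈ C, c.1.1 + 2 ≤ c.2.1)
    (hnc : ∀ c ∈ C, ∀ d ∈ C, c ≠ d →
      ¬((c.1.1 < d.1.1 ∧ d.1.1 < c.2.1 ∧ c.2.1 < d.2.1) ∨
        (d.1.1 < c.1.1 ∧ c.1.1 < d.2.1 ∧ d.2.1 < c.2.1)))
    (Vstar : Set (Fin k)) (hcover : ∀ c ∈ C, c.1 ∈ Vstar ∨ c.2 ∈ Vstar) :
    ∃ s : Fin k → ℝ, (∀ i, 0 ≤ s i) ∧ (∀ i, i ∉ Vstar → s i = 0) ∧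
      ∀ c ∈ C, ∀ m, c.1 < m → m < c.2 →
        0 < ((v c.2).1 - (v c.1).1) * ((v m).2 - s m)
          - ((v c.2).1 - (v m).1) * ((v c.1).2 - s c.1)
          - ((v m).1 - (v c.1).1) * ((v c.2).2 - s c.2) := by
  classical
  let q : Fin k × Fin k × Fin k → ℝ := fun t =>
    (|(v t.2.1).1 - (v t.1).1| + |((v t.2.1).1 - (v t.2.2).1) * (v t.1).2 +
      ((v t.2.2).1 - (v t.1).1) * (v t.2.1).2 - ((v t.2.1).1 - (v t.1).1) * (v t.2.2).2|)
      / |(v t.2.1).1 - (v t.2.2).1|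
  obtain ⟨B, hB⟩ := (Set.finite_range q).bddAbove
  have hB' : ∀ i j m, q (i, j, m) < max 1 (B + 1) := fun i j m =>
    lt_of_lt_of_le (lt_of_le_of_lt (hB ⟨_, rfl⟩) (lt_add_one B)) (le_max_right _ _)
  have hT1 : (1:ℝ) ≤ max 1 (B + 1) := le_max_left _ _
  generalize max 1 (B + 1) = T at hB' hT1
  let D : Fin k → Set (Fin k × Fin k) := fun m => {c | c ∈ C ∧ c.1 < m ∧ m < c.2}
  let d : Fin k → ℕ := fun m => (D m).ncard
  have hdN : ∀ m, d m ≤ C.ncard := fun m =>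
    Set.ncard_le_ncard (fun c hc => hc.1) C.toFinite
  have hdlt : ∀ c ∈ C, ∀ m, c.1 < m → m < c.2 → ∀ i, (i = c.1 ∨ i = c.2) → d i < d m := by
    intro c hc m h1 h2 i hi
    apply Set.ncard_lt_ncard _ (Set.toFinite _)
    rw [Set.ssubset_iff_of_subset]
    · refine ⟨c, ⟨hc, h1, h2⟩, ?_⟩
      rintro ⟨_, h3, h4⟩
      rcases hi with rfl | rfl
      · exact lt_irrefl _ h3
      · exact lt_irrefl _ h4
    · rintro e ⟨he, h3, h4⟩
      refine ⟨he, ?_⟩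
      have hne : c ≠ e := by
        rintro rfl
        rcases hi with rfl | rfl
        · exact lt_irrefl _ h3
        · exact lt_irrefl _ h4
      have := hnc c hc e he hne
      have := hC e he
      simp only [Fin.lt_def] at *
      rcases hi with rfl | rfl <;> omega
  let s : Fin k → ℝ := fun i => if i ∈ Vstar then T ^ (C.ncard - d i) else 0
  have hTp : ∀ n : ℕ, 1 ≤ T ^ n := fun n => one_le_pow₀ hT1
  have hs0 : ∀ i, 0 ≤ s i := by
    intro i; simp only [s]; split_ifs
    · linarith [hTp (C.ncard - d i)]
    · exact le_rfl
  have hsle : ∀ i, s i ≤ T ^ (C.ncard - d i) := by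
    intro i; simp only [s]; split_ifs
    · exact le_rfl
    · linarith [hTp (C.ncard - d i)]
  have hbig : ∀ i m, i ∈ Vstar → d i < d m → T * T ^ (C.ncard - d m) ≤ s i := by
    intro i m hi hd
    simp only [s, hi, if_true]
    rw [← pow_succ']
    apply pow_le_pow_right₀ hT1
    have := hdN m
    omega
  refine ⟨s, hs0, fun i hi => by simp [s, hi], ?_⟩
  intro c hc m h1 h2
  have x1 : (v c.1).1 < (v m).1 := hmono h1
  have x2 : (v m).1 < (v c.2).1 := hmono h2
  rcases hcover c hc with h | h
  · exact num_ineq _ _ _ _ _ _ T _ _ _ _ x1 x2 (hB' c.1 c.2 m) (hTp (C.ncard - d m))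
      (hsle m) (hbig _ _ h (hdlt c hc m h1 h2 _ (Or.inl rfl))) (hs0 _)
  · have hq := hB' c.2 c.1 m
    simp only [q] at hq
    have := num_ineq (-(v c.2).1) (-(v c.1).1) (-(v m).1) (v c.2).2 (v c.1).2 (v m).2 T
      (T ^ (C.ncard - d m)) (s c.2) (s c.1) (s m) (by linarith) (by linarith) ?_
      (hTp (C.ncard - d m))
      (hsle m) (hbig _ _ h (hdlt c hc m h1 h2 _ (Or.inr rfl))) (hs0 _)
    · linarith
    · convert hq using 2
      · congr 1
        · rw [← abs_neg]; congr 1; ring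
        · rw [← abs_neg]; congr 1; ring
      · rw [← abs_neg]; congr 1; ring

/-- Let `Π` be the x-monotone polygonal path through `v 0, …, v (k-1)`, let `C` be a
noncrossing set of chords of the path of indices, and `V*` a vertex cover of `C`.
Then the vertices in `V*` can be moved vertically down (all others staying fixed)
so that the path stays x-monotone, every chord of `C` drawn straight-line lies below
the new path, and the straight-line drawing of path edges plus chords is plane. -/
theorem modify_path_to_draw_chords (k : ℕ) (hk : 2 ≤ k) (v : Fin k → ℝ × ℝ)
    (hmono : StrictMono (fun i => (v i).1))
    (C : Set (Fin k × Fin k)) (hC : ∀ c ∈ C, c.1.1 + 2 ≤ c.2.1)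
    (hnc : ∀ c ∈ C, ∀ d ∈ C, c ≠ d →
      ¬((c.1.1 < d.1.1 ∧ d.1.1 < c.2.1 ∧ c.2.1 < d.2.1) ∨
        (d.1.1 < c.1.1 ∧ c.1.1 < d.2.1 ∧ d.2.1 < c.2.1)))
    (Vstar : Set (Fin k)) (hcover : ∀ c ∈ C, c.1 ∈ Vstar ∨ c.2 ∈ Vstar) :
    ∃ v' : Fin k → ℝ × ℝ,
      (∀ i, i ∉ Vstar → v' i = v i) ∧
      (∀ i ∈ Vstar, (v' i).1 = (v i).1 ∧ (v' i).2 ≤ (v i).2) ∧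
      StrictMono (fun i => (v' i).1) ∧
      (∀ c ∈ C, ∀ p ∈ segment ℝ (v' c.1) (v' c.2), BelowPath v' p) ∧
      ∀ (E : Set (Fin k × Fin k)),
        E = {e | (∃ h : e.1.1 + 1 < k, e.2 = ⟨e.1.1 + 1, h⟩) ∨ e ∈ C} →
        (∀ e ∈ E, ∀ m : Fin k, v' m ∈ segment ℝ (v' e.1) (v' e.2) → m = e.1 ∨ m = e.2) ∧
        (∀ e ∈ E, ∀ f ∈ E, ({e.1, e.2} : Set (Fin k)) ≠ ({f.1, f.2} : Set (Fin k)) →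
          ∀ p ∈ segment ℝ (v' e.1) (v' e.2), p ∈ segment ℝ (v' f.1) (v' f.2) →
            ∃ w : Fin k, (w = e.1 ∨ w = e.2) ∧ (w = f.1 ∨ w = f.2) ∧ p = v' w) := by
  obtain ⟨s, hs0, hsV, hs⟩ := heights k v hmono C hC hnc Vstar hcover
  have hm' : StrictMono (fun i => ((fun i => ((v i).1, (v i).2 - s i)) i : ℝ × ℝ).1) := hmono
  refine ⟨fun i => ((v i).1, (v i).2 - s i), ?_, ?_, hm', ?_, ?_⟩
  · intro i hi
    simp [hsV i hi]
  · intro i _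
    exact ⟨rfl, by simpa using hs0 i⟩
  · intro c hc p hp
    refine below_chord _ hm' c.1 c.2 ?_ (fun m h1 h2 => hs c hc m h1 h2) p hp
    have := hC c hc
    rw [Fin.lt_def]; omega
  · rintro E rfl
    generalize hv' : (fun i => ((v i).1, (v i).2 - s i) : Fin k → ℝ × ℝ) = v' at hm'
    have hE1 : ∀ e ∈ {e : Fin k × Fin k |
        (∃ h : e.1.1 + 1 < k, e.2 = ⟨e.1.1 + 1, h⟩) ∨ e ∈ C}, e.1 < e.2 := by
      rintro e (⟨h, he⟩ | he)
      · rw [he, Fin.lt_def]; simp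
      · have := hC e he
        rw [Fin.lt_def]; omega
    have hE2 : ∀ e ∈ {e : Fin k × Fin k |
        (∃ h : e.1.1 + 1 < k, e.2 = ⟨e.1.1 + 1, h⟩) ∨ e ∈ C},
        ∀ m, e.1 < m → m < e.2 → 0 < hgt (v' e.1) (v' e.2) (v' m) := by
      rintro e (⟨h, he⟩ | he) m h1 h2
      · rw [he] at h2
        simp only [Fin.lt_def] at h1 h2
        omega
      · subst hv'
        exact hs e he m h1 h2
    constructor
    · intro e he m hm
      have xe : (v' e.1).1 < (v' e.2).1 := hm' (hE1 e he)
      rw [mem_seg_iff _ _ _ xe] at hm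
      obtain ⟨p1, p2, p3⟩ := hm
      have q1 : e.1 ≤ m := hm'.le_iff_le.1 p1
      have q2 : m ≤ e.2 := hm'.le_iff_le.1 p2
      rcases eq_or_lt_of_le q1 with h | h
      · exact Or.inl h.symm
      rcases eq_or_lt_of_le q2 with h' | h'
      · exact Or.inr h'
      have := hE2 e he m h h'
      unfold hgt at this
      linarith
    · intro e he f hf hne p hpe hpf
      have le := hE1 e he
      have lf := hE1 f hf
      have hne' : e.1 ≠ f.1 ∨ e.2 ≠ f.2 := by
        by_contra hcon
        push Not at hcon
        exact hne (by rw [hcon.1, hcon.2])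
      have cases4 : e.2 ≤ f.1 ∨ f.2 ≤ e.1 ∨ (f.1 ≤ e.1 ∧ e.2 ≤ f.2) ∨
          (e.1 ≤ f.1 ∧ f.2 ≤ e.2) := by
        simp only [Fin.le_def, Fin.lt_def] at *
        rcases he with ⟨h, he⟩ | he
        · have : e.2.1 = e.1.1 + 1 := by rw [he]
          omega
        rcases hf with ⟨h, hf⟩ | hf
        · have : f.2.1 = f.1.1 + 1 := by rw [hf]
          omega
        have := hnc e he f hf (by rintro rfl; simp at hne)
        omega
      rcases cases4 with h | h | h | h
      · obtain ⟨h1, h2⟩ := disj_inter v' hm' _ _ _ _ le h lf p hpe hpf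
        exact ⟨e.2, Or.inr rfl, Or.inl h1, h2⟩
      · obtain ⟨h1, h2⟩ := disj_inter v' hm' _ _ _ _ lf h le p hpf hpe
        exact ⟨f.2, Or.inl h1, Or.inr rfl, h2⟩
      · exact nested_inter v' hm' _ _ _ _ h.1 le h.2
          (hne'.imp Ne.symm Ne.symm) (hE2 f hf) p hpe hpf
      · obtain ⟨w, a, b, c⟩ := nested_inter v' hm' _ _ _ _ h.1 lf h.2
          hne' (hE2 e he) p hpf hpe
        exact ⟨w, b, a, c⟩
end

section
/- Let k ≥ 3 and let v_1,…,v_k ∈ ℝ² be points with strictly increasing x-coordinates, let Π be the x-monotone polygonal path through v_1,…,v_k, and assume the segment [v_1, v_k] lies below Π. Let P = { p ∈ ℝ² : x(v_1) ≤ x(p) ≤ x(v_k), p lies below Π, and the point of [v_1, v_k] with the same x-coordinate as p has y-coordinate at most y(p) } be the region bounded above by Π and below by [v_1, v_k], and suppose P is star-shaped. Let v_k' be a point vertically below v_k (x(v_k') = x(v_k), y(v_k') ≤ y(v_k)), let Π' be the x-monotone polygonal path through v_1,…,v_{k−1},v_k', and let P' be the analogous region bounded above by Π' and below by [v_1, v_k'].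 Then P' is star-shaped. -/
/-- The kernel of a set `P`: the points of `P` that see every point of `P` inside `P`. -/
def kernelSet (P : Set (ℝ × ℝ)) : Set (ℝ × ℝ) :=
  {q | q ∈ P ∧ ∀ p ∈ P, segment ℝ q p ⊆ P}

/-- A set is *star-shaped* if the interior of its kernel is nonempty. -/
def StarShaped (P : Set (ℝ × ℝ)) : Prop := (interior (kernelSet P)).Nonempty

/-- The region bounded above by the x-monotone polygonal path through `v` and below
by the segment from the first to the last point of `v`. -/
def regionBelow (k : ℕ) (hk : 1 ≤ k) (v : Fin k → ℝ × ℝ) : Set (ℝ × ℝ) :=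
  {p | (v ⟨0, by omega⟩).1 ≤ p.1 ∧ p.1 ≤ (v ⟨k - 1, by omega⟩).1 ∧
    BelowPath v p ∧
    ∀ p' ∈ segment ℝ (v ⟨0, by omega⟩) (v ⟨k - 1, by omega⟩), p'.1 = p.1 → p'.2 ≤ p.2}

lemma seg_iff (u w p : ℝ × ℝ) (h : u.1 < w.1) :
    p ∈ segment ℝ u w ↔ u.1 ≤ p.1 ∧ p.1 ≤ w.1 ∧
      p.2 = u.2 + (w.2 - u.2) / (w.1 - u.1) * (p.1 - u.1) := by
  have hd : 0 < w.1 - u.1 := by linarith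
  constructor
  · rintro ⟨α, β, hα, hβ, hs, rfl⟩
    obtain rfl : α = 1 - β := by linarith
    simp only [Prod.fst_add, Prod.smul_fst, Prod.snd_add, Prod.smul_snd, smul_eq_mul]
    refine ⟨by nlinarith, by nlinarith, ?_⟩
    field_simp
    ring
  · rintro ⟨h1, h2, h3⟩
    refine ⟨1 - (p.1 - u.1) / (w.1 - u.1), (p.1 - u.1) / (w.1 - u.1), ?_, ?_, by ring, ?_⟩
    · rw [sub_nonneg, div_le_one hd]; linarith
    · apply div_nonneg <;> linarith
    · ext
      · simp only [Prod.fst_add, Prod.smul_fst, smul_eq_mul]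
        field_simp
        ring
      · simp only [Prod.snd_add, Prod.smul_snd, smul_eq_mul]
        rw [h3]
        field_simp
        ring

lemma belowPath_agree {k : ℕ} (v w : Fin k → ℝ × ℝ)
    (hv : StrictMono (fun i => (v i).1)) 
    (hvw : ∀ i : Fin k, i.1 < k - 1 → w i = v i) (ic : Fin k) (hic : ic.1 + 2 = k)
    (hk : 3 ≤ k) (p : ℝ × ℝ) (hp : p.1 ≤ (v ic).1) (h : BelowPath v p) : BelowPath w p := by
  obtain ⟨p', hp', h1, h2⟩ := h
  simp only [pathSet, Set.mem_iUnion] at hp'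
  obtain ⟨i, hi, hs⟩ := hp'
  refine ⟨p', ?_, h1, h2⟩
  simp only [pathSet, Set.mem_iUnion]
  refine ⟨i, hi, ?_⟩
  by_cases hlt : i.1 + 1 < k - 1
  · rw [hvw i (by omega), hvw ⟨i.1 + 1, hi⟩ hlt]; exact hs
  · have e : i = ic := Fin.ext (by omega)
    subst e
    have hlt2 : (v i).1 < (v ⟨i.1 + 1, hi⟩).1 := hv (by simp [Fin.lt_def])
    rw [seg_iff _ _ _ hlt2] at hs
    have e1 : p'.1 = (v i).1 := le_antisymm (by linarith) hs.1
    have e2 : p' = v i := by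
      ext
      · exact e1
      · rw [hs.2.2, e1]; ring
    rw [hvw i (by omega), e2]
    exact left_mem_segment _ _ _

lemma belowPath_last {k : ℕ} (v : Fin k → ℝ × ℝ)
    (hv : StrictMono (fun i => (v i).1)) (ic ib : Fin k) (hic : ic.1 + 2 = k)
    (hib : ib.1 + 1 = k) (p : ℝ × ℝ) (hp : (v ic).1 ≤ p.1) (hpb : p.1 ≤ (v ib).1) :
    BelowPath v p ↔ p.2 ≤ (v ic).2 +
      ((v ib).2 - (v ic).2) / ((v ib).1 - (v ic).1) * (p.1 - (v ic).1) := by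
  have hcb : (v ic).1 < (v ib).1 := hv (by rw [Fin.lt_def]; omega)
  have hib' : ∀ h, (⟨ic.1 + 1, h⟩ : Fin k) = ib := fun h => Fin.ext (by simp only; omega)
  constructor
  · rintro ⟨p', hp', h1, h2⟩
    simp only [pathSet, Set.mem_iUnion] at hp'
    obtain ⟨i, hi, hs⟩ := hp'
    have hlt2 : (v i).1 < (v ⟨i.1 + 1, hi⟩).1 := hv (by simp [Fin.lt_def])
    rw [seg_iff _ _ _ hlt2] at hs
    obtain ⟨hs1, hs2, hs3⟩ := hs
    by_cases e : i = ic
    · subst e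
      rw [hib'] at hs3
      rw [← h1, ← hs3]; exact h2
    · have hle : (⟨i.1 + 1, hi⟩ : Fin k) ≤ ic := by
        rw [Fin.le_def]; simp only
        have : i.1 ≠ ic.1 := fun h => e (Fin.ext h)
        have hne : i.1 ≠ ib.1 := by omega
        omega
      have hle2 : (v ⟨i.1 + 1, hi⟩).1 ≤ (v ic).1 := hv.monotone hle
      have e1 : (v ⟨i.1 + 1, hi⟩).1 = (v ic).1 := by linarith
      have e2 : (⟨i.1 + 1, hi⟩ : Fin k) = ic := hv.injective e1
      rw [e2] at hs3 hlt2
      have e3 : p'.1 = (v ic).1 := by linarith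
      rw [e3, div_mul_cancel₀ _ (by linarith)] at hs3
      rw [← h1, e3]
      linarith
  · intro h
    refine ⟨(p.1, (v ic).2 +
      ((v ib).2 - (v ic).2) / ((v ib).1 - (v ic).1) * (p.1 - (v ic).1)), ?_, rfl, h⟩
    simp only [pathSet, Set.mem_iUnion]
    refine ⟨ic, by omega, ?_⟩
    rw [hib', seg_iff _ _ _ hcb]
    exact ⟨hp, hpb, rfl⟩

lemma region_eq (k : ℕ) (hk : 1 ≤ k) (hk2 : 2 ≤ k) (v : Fin k → ℝ × ℝ)
    (hv : StrictMono (fun i => (v i).1)) (ia ib : Fin k) (hia : ia.1 = 0) (hib : ib.1 + 1 = k) :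
    regionBelow k hk v = {p | (v ia).1 ≤ p.1 ∧ p.1 ≤ (v ib).1 ∧ BelowPath v p ∧
      (v ia).2 + ((v ib).2 - (v ia).2) / ((v ib).1 - (v ia).1) * (p.1 - (v ia).1) ≤ p.2} := by
  have hab : (v ia).1 < (v ib).1 := hv (by rw [Fin.lt_def]; omega)
  have e1 : (⟨0, by omega⟩ : Fin k) = ia := Fin.ext hia.symm
  have e2 : (⟨k - 1, by omega⟩ : Fin k) = ib := Fin.ext (by simp only; omega)
  ext p
  simp only [regionBelow, Set.mem_ofPred_eq, e1, e2]
  refine and_congr_right fun h1 => and_congr_right fun h2 => and_congr_right fun _ => ?_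
  constructor
  · intro h
    refine h (p.1, (v ia).2 + ((v ib).2 - (v ia).2) / ((v ib).1 - (v ia).1) * (p.1 - (v ia).1))
      ?_ rfl
    rw [seg_iff _ _ _ hab]
    exact ⟨h1, h2, rfl⟩
  · intro h p' hp' e
    rw [seg_iff _ _ _ hab] at hp'
    rw [hp'.2.2, e]; exact h

lemma mem_seg_s13 (q p : ℝ × ℝ) (s : ℝ) (h0 : 0 ≤ s) (h1 : s ≤ 1) :
    ((1 - s) * q.1 + s * p.1, (1 - s) * q.2 + s * p.2) ∈ segment ℝ q p :=
  ⟨1 - s, s, by linarith, h0, by ring, by ext <;> simp⟩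

set_option maxHeartbeats 1000000 in
lemma core (a c b ya yc yb yb' m n m' n' : ℝ) (D D' : ℝ × ℝ → Prop)
    (hac : a < c) (hcb : c < b) (hyb : yb' ≤ yb)
    (hn : ya + n * (b - a) = yb) (hn' : ya + n' * (b - a) = yb')
    (hm : yc + m * (b - c) = yb) (hm' : yc + m' * (b - c) = yb')
    (hDd : ∀ x y z, y ≤ z → D (x, z) → D (x, y))
    (hDL : ∀ x, a ≤ x → x ≤ b → D (x, ya + n * (x - a)))
    (hDD : ∀ x y, x ≤ c → (D' (x, y) ↔ D (x, y)))
    (hD : ∀ x y, c ≤ x → x ≤ b → (D (x, y) ↔ y ≤ yc + m * (x - c)))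
    (hD' : ∀ x y, c ≤ x → x ≤ b → (D' (x, y) ↔ y ≤ yc + m' * (x - c)))
    (hstar : StarShaped {p | a ≤ p.1 ∧ p.1 ≤ b ∧ D p ∧ ya + n * (p.1 - a) ≤ p.2}) :
    StarShaped {p | a ≤ p.1 ∧ p.1 ≤ b ∧ D' p ∧ ya + n' * (p.1 - a) ≤ p.2} := by
  set P : Set (ℝ × ℝ) := {p | a ≤ p.1 ∧ p.1 ≤ b ∧ D p ∧ ya + n * (p.1 - a) ≤ p.2} with hP
  obtain ⟨q, hq⟩ := hstar
  obtain ⟨ε, hε, hball⟩ : ∃ ε > 0, ∀ x y : ℝ, |x - q.1| < ε → |y - q.2| < ε →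
      (x, y) ∈ kernelSet P := by
    rw [mem_interior_iff_mem_nhds, Metric.mem_nhds_iff] at hq
    obtain ⟨ε, hε, h⟩ := hq
    refine ⟨ε, hε, fun x y hx hy => h ?_⟩
    rw [Metric.mem_ball, Prod.dist_eq]
    exact max_lt hx hy
  have hz : |(0:ℝ)| < ε := by simpa using hε
  have hhalf : |ε / 2| < ε := by rw [abs_of_pos (by linarith)]; linarith
  have hhalf' : |-(ε / 2)| < ε := by rw [abs_neg]; exact hhalf
  have hqK : (q.1, q.2) ∈ kernelSet P := hball _ _ (by simpa using hε) (by simpa using hε)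
  have hqb : q.1 < b := by
    have := (hball (q.1 + ε / 2) q.2 (by simpa using hhalf) (by simpa using hε)).1.2.1
    simp only at this
    linarith
  have hqa : a ≤ q.1 := hqK.1.1
  have hqL : ya + n * (q.1 - a) < q.2 := by
    have := (hball q.1 (q.2 - ε / 2) (by simpa using hε) (by simpa using hhalf)).1.2.2.2
    simp only at this
    linarith
  have hnn : n' ≤ n := by
    by_contra! h
    nlinarith
  have hmm : m' ≤ m := by
    by_contra! h
    nlinarith
  -- `v_{k-1}` is strictly above the chord
  have hc : ya + n * (c - a) < yc := by
    have key : ∀ x, a ≤ x → x ≤ b → ∀ s, 0 ≤ s → s < 1 → (1 - s) * q.1 + s * x = c →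
        ya + n * (c - a) < yc := by
      intro x hxa hxb s h0 h1 he
      have hpP : (x, ya + n * (x - a)) ∈ P := ⟨hxa, hxb, hDL x hxa hxb, le_rfl⟩
      have := hqK.2 _ hpP (mem_seg_s13 _ _ s h0 h1.le)
      simp only [he] at this
      have h3 := (hD c _ le_rfl hcb.le).1 this.2.2.1
      have h4 : ya + n * (c - a) < (1 - s) * q.2 + s * (ya + n * (x - a)) := by
        rw [← he]
        nlinarith
      linarith
    rcases le_total c q.1 with h | h
    · refine key a le_rfl (by linarith) ((q.1 - c) / (q.1 - a)) ?_ ?_ ?_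
      · exact div_nonneg (by linarith) (by linarith)
      · rw [div_lt_one (by linarith)]; linarith
      · have : q.1 - a ≠ 0 := by linarith
        field_simp; ring
    · refine key b (by linarith) le_rfl ((c - q.1) / (b - q.1)) ?_ ?_ ?_
      · exact div_nonneg (by linarith) (by linarith)
      · rw [div_lt_one (by linarith)]; linarith
      · have : b - q.1 ≠ 0 := by linarith
        field_simp; ring
  have hmn' : m' < n' := by
    by_contra! h
    nlinarith
  -- visibility for `D`
  have K : ∀ s t x y l, |s - q.1| < ε → t ≤ q.2 → a ≤ x → x ≤ b → D (x, y) →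
      0 ≤ l → l ≤ 1 → D ((1 - l) * s + l * x, (1 - l) * t + l * y) := by
    intro s t x y l hs ht hxa hxb hxy h0 h1
    have hpP : (x, max y (ya + n * (x - a))) ∈ P := by
      refine ⟨hxa, hxb, ?_, le_max_right _ _⟩
      rcases max_choice y (ya + n * (x - a)) with h | h
      · rw [h]; exact hxy
      · rw [h]; exact hDL x hxa hxb
    have := (hball s q.2 hs (by simpa using hε)).2 _ hpP (mem_seg_s13 _ _ l h0 h1)
    refine hDd _ _ _ ?_ this.2.2.1
    have := le_max_left y (ya + n * (x - a))
    simp only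
    have h1' : 0 ≤ 1 - l := by linarith
    gcongr
  let U : Set (ℝ × ℝ) := {p | |p.1 - q.1| < ε ∧ ya + n' * (p.1 - a) < p.2 ∧ p.2 < q.2 ∧
    p.2 < yc + m' * (p.1 - c)}
  have hUo : IsOpen U := by
    have o1 : IsOpen {p : ℝ × ℝ | |p.1 - q.1| < ε} := isOpen_lt (by fun_prop) (by fun_prop)
    have o2 : IsOpen {p : ℝ × ℝ | ya + n' * (p.1 - a) < p.2} :=
      isOpen_lt (by fun_prop) (by fun_prop)
    have o3 : IsOpen {p : ℝ × ℝ | p.2 < q.2} := isOpen_lt (by fun_prop) (by fun_prop)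
    have o4 : IsOpen {p : ℝ × ℝ | p.2 < yc + m' * (p.1 - c)} :=
      isOpen_lt (by fun_prop) (by fun_prop)
    exact o1.inter (o2.inter (o3.inter o4))
  have hUn : U.Nonempty := by
    have h1 : ya + n' * (q.1 - a) < min q.2 (yc + m' * (q.1 - c)) := by
      refine lt_min (by nlinarith) ?_
      nlinarith
    obtain ⟨t, ht1, ht2⟩ := exists_between h1
    exact ⟨(q.1, t), by simpa using hε, ht1, (lt_min_iff.1 ht2).1, (lt_min_iff.1 ht2).2⟩
  obtain ⟨r, hr⟩ := hUn
  refine ⟨r, interior_maximal ?_ hUo hr⟩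
  rintro ⟨s, t⟩ ⟨hs, ht1, ht2, ht3⟩
  simp only at hs ht1 ht2 ht3
  obtain ⟨hsa, hsb, hsD, -⟩ := (hball s q.2 hs (by simpa using hε)).1
  simp only at hsa hsb
  refine ⟨⟨hsa, hsb, ?_, ht1.le⟩, ?_⟩
  · rcases le_total s c with h | h
    · exact (hDD _ _ h).2 (hDd _ _ _ ht2.le hsD)
    · exact (hD' _ _ h hsb).2 ht3.le
  rintro ⟨x, y⟩ ⟨hxa, hxb, hxD, hxL⟩
  simp only at hxa hxb hxL
  rintro _ ⟨l', l, hl', hl, hll, rfl⟩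
  obtain rfl : l' = 1 - l := by linarith
  have hl1 : l ≤ 1 := by linarith
  have hxDD : D (x, y) := by
    rcases le_total x c with h | h
    · exact (hDD _ _ h).1 hxD
    · rw [hD' _ _ h hxb] at hxD
      rw [hD _ _ h hxb]
      nlinarith
  have e : (1 - l) • ((s, t) : ℝ × ℝ) + l • ((x, y) : ℝ × ℝ) =
      ((1 - l) * s + l * x, (1 - l) * t + l * y) := by ext <;> simp
  rw [e]
  have hl1' : 0 ≤ 1 - l := by linarith
  have hza : a ≤ (1 - l) * s + l * x := by nlinarith
  have hzb : (1 - l) * s + l * x ≤ b := by nlinarith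
  refine ⟨hza, hzb, ?_, ?_⟩
  · have hK := K s t x y l hs ht2.le hxa hxb hxDD hl hl1
    rcases le_total ((1 - l) * s + l * x) c with hzc | hzc
    · exact (hDD _ _ hzc).2 hK
    rw [hD' _ _ hzc hzb]
    rcases le_total c x with h | h
    · rw [hD' _ _ h hxb] at hxD
      have i1 := mul_le_mul_of_nonneg_left ht3.le hl1'
      have i2 := mul_le_mul_of_nonneg_left hxD hl
      linarith
    · rcases eq_or_lt_of_le h with h | h
      · rw [hD' _ _ h.ge hxb] at hxD
        have i1 := mul_le_mul_of_nonneg_left ht3.le hl1'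
        have i2 := mul_le_mul_of_nonneg_left hxD hl
        linarith
      have hcs : c ≤ s := by
        by_contra! h'
        have i1 := mul_le_mul_of_nonneg_left h'.le hl1'
        have i2 := mul_le_mul_of_nonneg_left h.le hl
        have i3 : l = 0 := by
          by_contra h0
          have := mul_lt_mul_of_pos_left h (lt_of_le_of_ne hl (Ne.symm h0))
          linarith
        subst i3
        linarith
      -- crossing at `c`
      have hd : 0 < s - x := by linarith
      obtain ⟨l₀, hl₀⟩ : ∃ l₀, l₀ = (s - c) / (s - x) := ⟨_, rfl⟩
      have h00 : 0 ≤ l₀ := hl₀ ▸ div_nonneg (by linarith) hd.le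
      have h01 : l₀ ≤ 1 := by rw [hl₀, div_le_one hd]; linarith
      have hmul : l₀ * (s - x) = s - c := by rw [hl₀]; field_simp
      have hK0 := K s t x y l₀ hs ht2.le hxa hxb hxDD h00 h01
      have ec : (1 - l₀) * s + l₀ * x = c := by linarith
      rw [ec, hD _ _ le_rfl hcb.le] at hK0
      have hll0 : l ≤ l₀ := by
        by_contra! h'
        have := mul_lt_mul_of_pos_right h' hd
        linarith
      -- define the defect g(l) = value - line, linear in l, ≤ 0 at 0 and l₀
      rcases eq_or_lt_of_le h00 with h0 | h0
      · have : l = 0 := by linarith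
        subst this
        linarith
      have g : l₀ * ((1 - l) * t + l * y - (yc + m' * ((1 - l) * s + l * x - c))) =
          (l₀ - l) * (t - (yc + m' * (s - c))) +
          l * (((1 - l₀) * t + l₀ * y) - (yc + m' * ((1 - l₀) * s + l₀ * x - c))) := by ring
      rw [ec] at g
      by_contra! hcon
      have g1 : (l₀ - l) * (t - (yc + m' * (s - c))) ≤ 0 :=
        mul_nonpos_of_nonneg_of_nonpos (by linarith) (by linarith)
      have g2 : l * (((1 - l₀) * t + l₀ * y) - (yc + m' * (c - c))) ≤ 0 :=
        mul_nonpos_of_nonneg_of_nonpos hl (by linarith)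
      have g3 : 0 < l₀ * ((1 - l) * t + l * y - (yc + m' * ((1 - l) * s + l * x - c))) :=
        mul_pos h0 (by linarith)
      linarith
  · simp only
    have i1 := mul_le_mul_of_nonneg_left ht1.le hl1'
    have i2 := mul_le_mul_of_nonneg_left hxL hl
    linarith

/-- Let `Π` be the x-monotone polygonal path through `v 0, …, v (k-1)` (`k ≥ 3`) such
that the segment from `v 0` to the last point lies below `Π` and the region `P`
bounded by `Π` and this segment is star-shaped.  Moving the last vertex vertically
down, the analogous region `P'` is again star-shaped. -/
theorem region_starShaped_move_last_down (k : ℕ) (hk : 3 ≤ k) (v : Fin k → ℝ × ℝ)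
    (hmono : StrictMono (fun i => (v i).1))
    (hbelow : ∀ p ∈ segment ℝ (v ⟨0, by omega⟩) (v ⟨k - 1, by omega⟩), BelowPath v p)
    (hstar : StarShaped (regionBelow k (by omega) v))
    (vk' : ℝ × ℝ)
    (hx : vk'.1 = (v ⟨k - 1, by omega⟩).1) (hy : vk'.2 ≤ (v ⟨k - 1, by omega⟩).2) :
    StarShaped (regionBelow k (by omega) (Function.update v ⟨k - 1, by omega⟩ vk')) := by
  obtain ⟨ia, hia⟩ : ∃ i : Fin k, i.1 = 0 := ⟨⟨0, by omega⟩, rfl⟩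
  obtain ⟨ic, hic⟩ : ∃ i : Fin k, i.1 + 2 = k := ⟨⟨k - 2, by omega⟩, by simp only; omega⟩
  obtain ⟨ib, hib⟩ : ∃ i : Fin k, i.1 + 1 = k := ⟨⟨k - 1, by omega⟩, by simp only; omega⟩
  have e1 : (⟨0, by omega⟩ : Fin k) = ia := Fin.ext hia.symm
  have e2 : (⟨k - 1, by omega⟩ : Fin k) = ib := Fin.ext (by simp only; omega)
  simp only [e1, e2] at hbelow hx hy ⊢
  obtain ⟨w, hw⟩ : ∃ w, w = Function.update v ib vk' := ⟨_, rfl⟩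
  rw [← hw]
  have hvw : ∀ i : Fin k, i.1 < k - 1 → w i = v i := by
    intro i hi
    rw [hw, Function.update_of_ne]
    rintro rfl
    omega
  have hwb : w ib = vk' := by simp [hw]
  have hx1 : ∀ i, (w i).1 = (v i).1 := by
    intro i
    by_cases h : i = ib
    · rw [h, hwb, hx]
    · rw [hw, Function.update_of_ne h]
  have hwm : StrictMono (fun i => (w i).1) := by simpa only [hx1] using hmono
  have hwa : w ia = v ia := hvw _ (by omega)
  have hwc : w ic = v ic := hvw _ (by omega)
  have hac : (v ia).1 < (v ic).1 := hmono (by rw [Fin.lt_def]; omega)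
  have hcb : (v ic).1 < (v ib).1 := hmono (by rw [Fin.lt_def]; omega)
  have hab := hac.trans hcb
  rw [region_eq k _ (by omega) v hmono ia ib hia hib] at hstar
  rw [region_eq k _ (by omega) w hwm ia ib hia hib]
  rw [hwa, hx1 ib, hwb]
  refine core (v ia).1 (v ic).1 (v ib).1 (v ia).2 (v ic).2 (v ib).2 vk'.2
    (((v ib).2 - (v ic).2) / ((v ib).1 - (v ic).1)) _
    ((vk'.2 - (v ic).2) / ((v ib).1 - (v ic).1)) _ (BelowPath v) (BelowPath w)
    hac hcb hy ?_ ?_ ?_ ?_ ?_ ?_ ?_ ?_ ?_ hstar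
  · rw [div_mul_cancel₀ _ (by linarith)]; ring
  · rw [div_mul_cancel₀ _ (by linarith)]; ring
  · rw [div_mul_cancel₀ _ (by linarith)]; ring
  · rw [div_mul_cancel₀ _ (by linarith)]; ring
  · rintro x y z hyz ⟨p', h1, h2, h3⟩
    exact ⟨p', h1, h2, hyz.trans h3⟩
  · intro x h1 h2
    apply hbelow
    rw [seg_iff _ _ _ hab]
    exact ⟨h1, h2, rfl⟩
  · intro x y h
    exact ⟨belowPath_agree w v hwm (fun i hi => (hvw i hi).symm) ic hic hk _ (by rw [hx1]; exact h),
      belowPath_agree v w hmono hvw ic hic hk _ h⟩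
  · intro x y h1 h2
    exact belowPath_last v hmono ic ib hic hib (x, y) h1 h2
  · intro x y h1 h2
    have := belowPath_last w hwm ic ib hic hib (x, y) (by rw [hwc]; exact h1)
      (by rw [hx1]; exact h2)
    rw [hwc, hx1 ib, hwb] at this
    exact this
end

section
/- Let q ≥ 2 and let H_q be the simple graph with vertex set {0,1,…,q²−1} ∪ {c} (where c is one additional vertex) and edge set consisting of the path edges {i, i+1} for 0 ≤ i < q²−1 together with the edges {c, i} for every 0 ≤ i ≤ q²−1. Let δ be the straight-line drawing of H_q that places all vertices on the horizontal line y = 0 as follows: for each position p ∈ {0,…,q²−1} the vertex σ_q(p) is placed at (p, 0), and δ(c) = (q², 0). Then H_q is planar, every plane straight-line drawing δ' of H_q satisfies |{ v : δ'(v) = δ(v) }| ≤ 2q + 1, and there exists a plane straight-line drawing δ' of H_q with |{ v : δ'(v) = δ(v) }| ≥ 2q − 2; in other words 2q − 2 ≤ fix(H_q, δ) ≤ 2q + 1. -/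
/-- A straight-line drawing `δ` of a simple graph `G` is *plane* if it is injective,
no vertex image lies on the segment of an edge except as one of its endpoints, and
any two distinct edges intersect only in images of common endpoints. -/
def IsPlaneDrawing {V : Type*} (G : SimpleGraph V) (δ : V → ℝ × ℝ) : Prop :=
  Function.Injective δ ∧
  (∀ u v w : V, G.Adj u v → δ w ∈ segment ℝ (δ u) (δ v) → w = u ∨ w = v) ∧
  (∀ u v a b : V, G.Adj u v → G.Adj a b → ({u, v} : Set V) ≠ ({a, b} : Set V) →
    ∀ p : ℝ × ℝ, p ∈ segment ℝ (δ u) (δ v) → p ∈ segment ℝ (δ a) (δ b) →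
      ∃ w : V, (w = u ∨ w = v) ∧ (w = a ∨ w = b) ∧ p = δ w)

/-- The sequence `σ_q`: the entry at position `p = i·q + j` (with `0 ≤ i, j ≤ q-1`)
is `(q-1-j)·q + i`. -/
def sigmaSeq (q p : ℕ) : ℕ := (q - 1 - p % q) * q + p / q

/-- The inverse of `σ_q` on `{0, …, q²-1}`: the position of value `m` in `σ_q`. -/
def sigmaPos (q m : ℕ) : ℕ := m % q * q + (q - 1 - m / q)

/-- The graph `H_q`: a path on the vertices `0, 1, …, q²-1` (the `Sum.inl` vertices),
all of them joined to one additional vertex `c = Sum.inr ()`. -/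
def Hq (q : ℕ) : SimpleGraph (Fin (q ^ 2) ⊕ Unit) :=
  SimpleGraph.fromRel fun u v =>
    match u, v with
    | Sum.inl i, Sum.inl j => j.1 = i.1 + 1
    | Sum.inr _, Sum.inl _ => True
    | _, _ => False

/-- The drawing `δ` of `H_q` placing all vertices on the horizontal line `y = 0`:
for each position `p` the vertex `σ_q(p)` at `(p, 0)` (i.e. vertex `m` at
`(σ_q⁻¹(m), 0)`), and `c` at `(q², 0)`. -/
def δHq (q : ℕ) : Fin (q ^ 2) ⊕ Unit → ℝ × ℝ
  | Sum.inr _ => ((q : ℝ) ^ 2, 0)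
  | Sum.inl m => ((sigmaPos q m.1 : ℝ), 0)

def cdet (u v : ℝ × ℝ) : ℝ := u.1 * v.2 - u.2 * v.1

def InCone (i j v : ℝ × ℝ) : Prop := ∃ α β : ℝ, 0 < α ∧ 0 < β ∧ v = α • i + β • j

theorem InCone.symm {i j v : ℝ × ℝ} (h : InCone i j v) : InCone j i v := by
  obtain ⟨α, β, ha, hb, h⟩ := h
  exact ⟨β, α, hb, ha, by rw [h, add_comm]⟩

theorem cramer (i j v : ℝ × ℝ) (hD : cdet i j ≠ 0) : ∃ α β : ℝ, v = α • i + β • j := by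
  refine ⟨cdet v j / cdet i j, cdet i v / cdet i j, ?_⟩
  ext
  · simp only [Prod.fst_add, Prod.smul_fst, smul_eq_mul]
    field_simp
    simp only [cdet]; ring
  · simp only [Prod.snd_add, Prod.smul_snd, smul_eq_mul]
    field_simp
    simp only [cdet]; ring

theorem cone_walk (i j v w : ℝ × ℝ) (hD : cdet i j ≠ 0) (hv : InCone i j v)
    (h0 : ∀ p, p ∈ segment ℝ 0 v → p ∈ segment ℝ i j → False)
    (h1 : ∀ p, p ∈ segment ℝ v w → p ∈ segment ℝ i j → False)
    (h2 : ∀ p, p ∈ segment ℝ v w → p ∈ segment ℝ 0 i → False)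
    (h3 : ∀ p, p ∈ segment ℝ v w → p ∈ segment ℝ 0 j → False) : InCone i j w := by
  obtain ⟨α, β, ha, hb, hv⟩ := hv
  obtain ⟨γ, ε, hw⟩ := cramer i j w hD
  have hlt : α + β < 1 := by
    by_contra hge
    push Not at hge
    have hpos : 0 < α + β := by linarith
    apply h0 ((1 / (α + β)) • v)
    · refine ⟨1 - 1 / (α + β), 1 / (α + β), ?_, by positivity, by ring, by simp⟩
      have : 1 / (α + β) ≤ 1 := by rw [div_le_one hpos]; exact hge
      linarith
    · refine ⟨α / (α + β), β / (α + β), by positivity, by positivity, by field_simp, ?_⟩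
      rw [hv, smul_add, smul_smul, smul_smul]
      congr 2 <;> ring
  by_contra hn
  have hn' : γ ≤ 0 ∨ ε ≤ 0 := by
    by_contra hc
    push Not at hc
    exact hn ⟨γ, ε, hc.1, hc.2, hw⟩
  let f : ℝ → ℝ := fun t => min (min ((1 - t) * α + t * γ) ((1 - t) * β + t * ε))
    (1 - ((1 - t) * α + t * γ) - ((1 - t) * β + t * ε))
  have hf : Continuous f := by fun_prop
  have hf0 : 0 ≤ f 0 := by
    simp only [f, le_min_iff]
    refine ⟨⟨?_, ?_⟩, ?_⟩ <;> linarith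
  have hf1 : f 1 ≤ 0 := by
    simp only [f, min_le_iff]
    left
    rcases hn' with h | h
    · left; linarith
    · right; linarith
  obtain ⟨t, ⟨ht0, ht1⟩, ht⟩ : (0:ℝ) ∈ f '' Set.Icc 0 1 :=
    intermediate_value_Icc' zero_le_one hf.continuousOn ⟨hf1, hf0⟩
  set A := (1 - t) * α + t * γ with hA
  set B := (1 - t) * β + t * ε with hB
  have hft : min (min A B) (1 - A - B) = 0 := ht
  have hpt : A • i + B • j ∈ segment ℝ v w := by
    refine ⟨1 - t, t, by linarith, ht0, by ring, ?_⟩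
    rw [hv, hw, hA, hB]
    module
  have hA0 : 0 ≤ A := by rw [← hft]; exact (min_le_left _ _).trans (min_le_left _ _)
  have hB0 : 0 ≤ B := by rw [← hft]; exact (min_le_left _ _).trans (min_le_right _ _)
  have hC0 : 0 ≤ 1 - A - B := by rw [← hft]; exact min_le_right _ _
  have hz : A = 0 ∨ B = 0 ∨ 1 - A - B = 0 := by
    rcases min_choice (min A B) (1 - A - B) with h | h
    · rcases min_choice A B with h' | h'
      · left; rw [← h', ← h, hft]
      · right; left; rw [← h', ← h, hft]
    · right; right; rw [← h, hft]
  rcases hz with h | h | h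
  · refine h3 _ hpt ⟨1 - B, B, by linarith, hB0, by ring, ?_⟩
    rw [h]; simp
  · refine h2 _ hpt ⟨1 - A, A, by linarith, hA0, by ring, ?_⟩
    rw [h]; simp
  · exact h1 _ hpt ⟨A, B, hA0, hB0, by linarith, rfl⟩

theorem cone_side (i j x y : ℝ × ℝ) (hxy : cdet x y ≠ 0) (hij : cdet i j ≠ 0)
    (hi : InCone x y i) (hjx : ∀ t : ℝ, 0 < t → j ≠ t • x) (hjy : ∀ t : ℝ, 0 < t → j ≠ t • y)
    (hiff : InCone i j x ↔ InCone i j y) : InCone x y j := by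
  obtain ⟨α, β, ha, hb, hi⟩ := hi
  obtain ⟨γ, ε, hj⟩ := cramer x y j hxy
  have hnot : ¬ InCone i j x := by
    intro hx
    obtain ⟨s, t, hs, ht, hx'⟩ := hx
    obtain ⟨s', t', hs', ht', hy'⟩ := hiff.1 ⟨s, t, hs, ht, hx'⟩
    have : cdet i i = (α * t + β * t') * cdet i j := by
      have : i = (α * s + β * s') • i + (α * t + β * t') • j := by
        conv_lhs => rw [hi, hx', hy']
        module
      have h1 := congrArg Prod.fst this
      have h2 := congrArg Prod.snd this
      simp only [Prod.fst_add, Prod.smul_fst, smul_eq_mul, Prod.snd_add, Prod.smul_snd] at h1 h2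
      simp only [cdet]
      linear_combination i.1 * h2 - i.2 * h1
    have h0 : cdet i i = 0 := by simp only [cdet]; ring
    rw [h0] at this
    have hp : 0 < α * t + β * t' := by positivity
    rcases mul_eq_zero.1 this.symm with h | h
    · linarith
    · exact hij h
  have hnoty : ¬ InCone i j y := fun h => hnot (hiff.2 h)
  have hE : cdet i j = (α * ε - β * γ) * cdet x y := by
    rw [hi, hj]; simp only [cdet, Prod.fst_add, Prod.smul_fst, smul_eq_mul, Prod.snd_add, Prod.smul_snd]
    ring
  have hE0 : α * ε - β * γ ≠ 0 := by
    intro h; rw [h, zero_mul] at hE; exact hij hE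
  obtain ⟨E, hEd⟩ : ∃ E, E = α * ε - β * γ := ⟨_, rfl⟩
  rw [← hEd] at hE0
  have hx : x = (ε / E) • i + (-β / E) • j := by
    rw [hi, hj]
    ext
    · simp only [Prod.fst_add, Prod.smul_fst, smul_eq_mul]; field_simp; linear_combination x.1 * hEd
    · simp only [Prod.snd_add, Prod.smul_snd, smul_eq_mul]; field_simp; linear_combination x.2 * hEd
  have hy : y = (-γ / E) • i + (α / E) • j := by
    rw [hi, hj]
    ext
    · simp only [Prod.fst_add, Prod.smul_fst, smul_eq_mul]; field_simp; linear_combination y.1 * hEd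
    · simp only [Prod.snd_add, Prod.smul_snd, smul_eq_mul]; field_simp; linear_combination y.2 * hEd
  rcases lt_or_gt_of_ne hE0 with hneg | hpos
  · have he : 0 ≤ ε := by
      by_contra hc
      push Not at hc
      exact hnot ⟨_, _, div_pos_of_neg_of_neg hc hneg,
        div_pos_of_neg_of_neg (by linarith) hneg, hx⟩
    have hg : 0 < γ := by
      have : 0 < β * γ := by nlinarith [mul_nonneg ha.le he]
      exact (pos_iff_pos_of_mul_pos this).1 hb
    rcases he.eq_or_lt with h | h
    · exact absurd (by rw [hj, ← h]; simp) (hjx γ hg)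
    · exact ⟨γ, ε, hg, h, hj⟩
  · have hg : 0 ≤ γ := by
      by_contra hc
      push Not at hc
      exact hnoty ⟨_, _, div_pos (by linarith) hpos, div_pos ha hpos, hy⟩
    have he : 0 < ε := by
      have : 0 < α * ε := by nlinarith [mul_nonneg hb.le hg]
      exact (pos_iff_pos_of_mul_pos this).1 ha
    rcases hg.eq_or_lt with h | h
    · exact absurd (by rw [hj, ← h]; simp) (hjy ε he)
    · exact ⟨γ, ε, h, he, hj⟩
theorem plane_translate {V : Type*} {G : SimpleGraph V} {δ : V → ℝ × ℝ} (c : ℝ × ℝ)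
    (h : IsPlaneDrawing G δ) : IsPlaneDrawing G (fun v => c + δ v) := by
  obtain ⟨h1, h2, h3⟩ := h
  refine ⟨fun a b hab => h1 (add_left_cancel hab), fun u v w huv hw =>
    h2 u v w huv ((mem_segment_translate ℝ c).1 hw), fun u v a b huv hab hne p hp hp' => ?_⟩
  obtain ⟨p, rfl⟩ : ∃ p', p = c + p' := ⟨p - c, by abel⟩
  obtain ⟨w, hw1, hw2, hw3⟩ := h3 u v a b huv hab hne p ((mem_segment_translate ℝ c).1 hp)
    ((mem_segment_translate ℝ c).1 hp')
  exact ⟨w, hw1, hw2, by rw [hw3]⟩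

structure FanAt (n : ℕ) (P : ℕ → ℝ × ℝ) : Prop where
  spoke_path : ∀ m k, m < n → k + 1 < n → m ≠ k → m ≠ k + 1 →
    ∀ p, p ∈ segment ℝ 0 (P m) → p ∈ segment ℝ (P k) (P (k+1)) → False
  path_path : ∀ m k, m + 1 < n → k + 1 < n → m ≠ k → m ≠ k + 1 → m + 1 ≠ k →
    ∀ p, p ∈ segment ℝ (P m) (P (m+1)) → p ∈ segment ℝ (P k) (P (k+1)) → False
  spoke : ∀ m k, m < n → k < n → m ≠ k → P m ∉ segment ℝ 0 (P k)
  center : ∀ k, k + 1 < n → (0 : ℝ × ℝ) ∉ segment ℝ (P k) (P (k+1))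

theorem cdet_zero (u v : ℝ × ℝ) (hv : v ≠ 0) (h : cdet u v = 0) : ∃ t : ℝ, u = t • v := by
  simp only [cdet] at h
  have hv' : 0 < v.1 ^ 2 + v.2 ^ 2 := by
    by_contra hc
    have h1 : v.1 = 0 := by nlinarith [sq_nonneg v.1, sq_nonneg v.2]
    have h2 : v.2 = 0 := by nlinarith [sq_nonneg v.1, sq_nonneg v.2]
    exact hv (Prod.ext h1 h2)
  refine ⟨(u.1 * v.1 + u.2 * v.2) / (v.1 ^ 2 + v.2 ^ 2), ?_⟩
  ext
  · simp only [Prod.smul_fst, smul_eq_mul]; field_simp; linear_combination v.2 * h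
  · simp only [Prod.smul_snd, smul_eq_mul]; field_simp; linear_combination -v.1 * h

namespace FanAt
variable {n : ℕ} {P : ℕ → ℝ × ℝ}

theorem no_mul (H : FanAt n P) {m k : ℕ} (hm : m < n) (hk : k < n) (hmk : m ≠ k)
    (t : ℝ) (ht : 0 ≤ t) : P m ≠ t • P k := by
  intro h
  rcases le_total t 1 with h1 | h1
  · exact H.spoke m k hm hk hmk ⟨1 - t, t, by linarith, ht, by ring, by rw [h]; simp⟩
  · have h0 : 0 < t := by linarith
    refine H.spoke k m hk hm hmk.symm ⟨1 - 1 / t, 1 / t, ?_, by positivity, by ring, ?_⟩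
    · have : 1 / t ≤ 1 := by rw [div_le_one h0]; exact h1
      linarith
    · rw [h, smul_smul, one_div_mul_cancel h0.ne']; simp

theorem ne_zero (H : FanAt n P) {m k : ℕ} (hm : m < n) (hk : k < n) (hmk : m ≠ k) : P m ≠ 0 := by
  have := H.no_mul hm hk hmk 0 le_rfl
  simpa using this

theorem det_ne (H : FanAt n P) {k : ℕ} (hk : k + 1 < n) : cdet (P k) (P (k+1)) ≠ 0 := by
  intro h
  obtain ⟨t, ht⟩ := cdet_zero _ _ (H.ne_zero hk (by omega : k < n) (by omega)) h
  rcases le_total 0 t with h0 | h0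
  · exact H.no_mul (by omega) hk (by omega) t h0 ht
  · have hp : 0 < 1 - t := by linarith
    refine H.center k hk ⟨1 / (1 - t), -t / (1 - t), by positivity,
      div_nonneg (by linarith) hp.le, by field_simp; ring, ?_⟩
    rw [ht, smul_smul, ← add_smul]
    have : 1 / (1 - t) * t + -t / (1 - t) = 0 := by ring
    rw [this, zero_smul]

theorem step (H : FanAt n P) {i v : ℕ} (hi : i + 1 < n) (hv : v + 1 < n) (h1 : v ≠ i)
    (h2 : v ≠ i + 1) (h3 : v + 1 ≠ i) :
    InCone (P i) (P (i+1)) (P v) ↔ InCone (P i) (P (i+1)) (P (v+1)) := by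
  constructor
  · intro h
    refine cone_walk _ _ (P v) _ (H.det_ne hi) h (H.spoke_path v i (by omega) hi h1 h2)
      (H.path_path v i hv hi h1 h2 h3)
      (fun p hp hp' => H.spoke_path i v (by omega) hv (by omega) (by omega) p hp' hp)
      (fun p hp hp' => H.spoke_path (i+1) v (by omega) hv (by omega) (by omega) p hp' hp)
  · intro h
    refine cone_walk _ _ (P (v+1)) _ (H.det_ne hi) h
      (H.spoke_path (v+1) i (by omega) hi (by omega) (by omega))
      (fun p hp => ?_) (fun p hp hp' => ?_) (fun p hp hp' => ?_)
    · rw [segment_symm] at hp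
      exact H.path_path v i hv hi h1 h2 h3 p hp
    · rw [segment_symm] at hp
      exact H.spoke_path i v (by omega) hv (by omega) (by omega) p hp' hp
    · rw [segment_symm] at hp
      exact H.spoke_path (i+1) v (by omega) hv (by omega) (by omega) p hp' hp

theorem steps (H : FanAt n P) {i x y : ℕ} (hi : i + 1 < x) (hxy : x ≤ y) (hy : y < n) :
    InCone (P i) (P (i+1)) (P x) ↔ InCone (P i) (P (i+1)) (P y) := by
  induction y, hxy using Nat.le_induction with
  | base => rfl
  | succ y hxy ih =>
    rw [ih (by omega)]
    exact H.step (by omega) hy (by omega) (by omega) (by omega)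

theorem side (H : FanAt n P) {a b x y : ℕ} (hab : a ≤ b) (hbx : b < x) (hxy : x ≤ y) (hy : y < n)
    (hD : cdet (P x) (P y) ≠ 0) :
    InCone (P x) (P y) (P a) ↔ InCone (P x) (P y) (P b) := by
  induction b, hab using Nat.le_induction with
  | base => rfl
  | succ b hab ih =>
    rw [ih (by omega)]
    have hs := H.steps hbx hxy hy
    have hd := H.det_ne (k := b) (by omega)
    constructor
    · intro h
      exact cone_side _ _ _ _ hD hd h
        (fun t ht => H.no_mul (by omega) (by omega) (by omega) t ht.le)
        (fun t ht => H.no_mul (by omega) (by omega) (by omega) t ht.le) hs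
    · intro h
      refine cone_side (P (b+1)) _ _ _ hD ?_ h
        (fun t ht => H.no_mul (by omega) (by omega) (by omega) t ht.le)
        (fun t ht => H.no_mul (by omega) (by omega) (by omega) t ht.le)
        ⟨fun h => (hs.1 h.symm).symm, fun h => (hs.2 h.symm).symm⟩
      intro h; apply hd; simp only [cdet] at h ⊢; linarith

end FanAt

theorem Hq_adj_c (q : ℕ) (i : Fin (q^2)) : (Hq q).Adj (Sum.inr ()) (Sum.inl i) := by
  simp [Hq]

theorem Hq_adj_path (q k : ℕ) (h : k + 1 < q^2) :
    (Hq q).Adj (Sum.inl ⟨k, by omega⟩) (Sum.inl ⟨k+1, h⟩) := by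
  simp [Hq]

theorem fanAt_of_plane (q : ℕ) (δ : Fin (q ^ 2) ⊕ Unit → ℝ × ℝ) (h : IsPlaneDrawing (Hq q) δ)
    (h0 : δ (Sum.inr ()) = 0) (P : ℕ → ℝ × ℝ) (hP : ∀ m (hm : m < q^2), P m = δ (Sum.inl ⟨m, hm⟩)) :
    FanAt (q^2) P := by
  obtain ⟨h1, h2, h3⟩ := h
  constructor
  · intro m k hm hk hmk hmk' p hp hp'
    rw [hP m hm, ← h0] at hp
    rw [hP k (by omega), hP (k+1) hk] at hp'
    obtain ⟨w, hw1, hw2, -⟩ := h3 _ _ _ _ (Hq_adj_c q ⟨m, hm⟩) (Hq_adj_path q k hk) (by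
      intro h
      have : Sum.inr () ∈ ({Sum.inl ⟨k, by omega⟩, Sum.inl ⟨k+1, hk⟩} : Set (Fin (q ^ 2) ⊕ Unit)) := by
        rw [← h]; simp
      simp at this) p hp hp'
    rcases hw1 with rfl | rfl <;> simp at hw2 <;> omega
  · intro m k hm hk hmk hmk' hmk'' p hp hp'
    rw [hP m (by omega), hP (m+1) hm] at hp
    rw [hP k (by omega), hP (k+1) hk] at hp'
    obtain ⟨w, hw1, hw2, -⟩ := h3 _ _ _ _ (Hq_adj_path q m hm) (Hq_adj_path q k hk) (by
      intro h
      have : Sum.inl ⟨m, by omega⟩ ∈ ({Sum.inl ⟨k, by omega⟩, Sum.inl ⟨k+1, hk⟩} : Set (Fin (q ^ 2) ⊕ Unit)) := by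
        rw [← h]; simp
      simp at this; omega) p hp hp'
    rcases hw1 with rfl | rfl <;> simp at hw2 <;> omega
  · intro m k hm hk hmk hp
    rw [hP m hm, hP k hk, ← h0] at hp
    have := h2 _ _ _ (Hq_adj_c q ⟨k, hk⟩) hp
    simp at this; omega
  · intro k hk hp
    rw [hP (k+1) hk, hP k (by omega), ← h0] at hp
    have := h2 _ _ _ (Hq_adj_path q k hk) hp
    simp at this

/-- The combinatorial condition obtained from a plane drawing. -/
theorem cond_of_plane (q : ℕ) (δ : Fin (q ^ 2) ⊕ Unit → ℝ × ℝ) (h : IsPlaneDrawing (Hq q) δ)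
    (hc : (δ (Sum.inr ())).2 ≠ 0) (a b x y : Fin (q^2)) (hab : a ≤ b) (hbx : b < x) (hxy : x < y)
    (pa pb px py : ℝ) (ha : δ (Sum.inl a) = (pa, 0)) (hb : δ (Sum.inl b) = (pb, 0))
    (hx : δ (Sum.inl x) = (px, 0)) (hy : δ (Sum.inl y) = (py, 0)) :
    ((px < pa ∧ pa < py) ∨ (py < pa ∧ pa < px)) ↔ ((px < pb ∧ pb < py) ∨ (py < pb ∧ pb < px)) := by
  set c := δ (Sum.inr ()) with hcdef
  have hpl := plane_translate (-c) h
  set P : ℕ → ℝ × ℝ := fun m => if hm : m < q^2 then -c + δ (Sum.inl ⟨m, hm⟩) else 0 with hP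
  have H := fanAt_of_plane q _ hpl (by simp [hcdef]) P (by intro m hm; simp [hP, hm])
  have hval : ∀ (m : Fin (q^2)) (p : ℝ), δ (Sum.inl m) = (p, 0) → P m = (p - c.1, - c.2) := by
    intro m p hm
    simp only [hP, m.2, dif_pos, Fin.eta, hm]
    ext
    · simp; ring
    · simp
  have hxyne : px ≠ py := by
    intro he
    have := h.1 (hx.trans (he ▸ hy.symm))
    simp at this; omega
  have hD : cdet (P x) (P y) ≠ 0 := by
    rw [hval x px hx, hval y py hy]
    have : cdet (px - c.1, -c.2) (py - c.1, -c.2) = c.2 * (py - px) := by simp only [cdet]; ring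
    rw [this]
    exact mul_ne_zero hc (sub_ne_zero.2 hxyne.symm)
  have key : ∀ (m : Fin (q^2)) (p : ℝ), δ (Sum.inl m) = (p, 0) →
      (InCone (P x) (P y) (P m) ↔ ((px < p ∧ p < py) ∨ (py < p ∧ p < px))) := by
    intro m p hm
    rw [hval x px hx, hval y py hy, hval m p hm]
    constructor
    · rintro ⟨α, β, h1, h2, h3⟩
      have e1 := congrArg Prod.fst h3
      have e2 := congrArg Prod.snd h3
      simp at e1 e2
      have e3 : α + β = 1 := mul_left_cancel₀ hc (by linarith)
      have hβ : β = 1 - α := by linarith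
      subst hβ
      have e4 : p = α * px + (1 - α) * py := by linarith
      rcases lt_or_gt_of_ne hxyne with hl | hl
      · left; constructor <;> nlinarith
      · right; constructor <;> nlinarith
    · intro hh
      have hne : py - px ≠ 0 := sub_ne_zero.2 hxyne.symm
      refine ⟨(py - p) / (py - px), (p - px) / (py - px), ?_, ?_, ?_⟩
      · rcases hh with hh | hh
        · apply div_pos <;> linarith
        · apply div_pos_of_neg_of_neg <;> linarith
      · rcases hh with hh | hh
        · apply div_pos <;> linarith
        · apply div_pos_of_neg_of_neg <;> linarith
      · ext
        · simp; field_simp; ring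
        · simp; field_simp; ring
  rw [← key a pa ha, ← key b pb hb]
  exact H.side hab hbx hxy.le y.2 hD
theorem sigmaPos_div (q m : ℕ) (hq : 0 < q) : sigmaPos q m / q = m % q := by
  unfold sigmaPos
  rw [mul_comm, Nat.mul_add_div hq, Nat.div_eq_of_lt (lt_of_le_of_lt (Nat.sub_le _ _) (by omega : q - 1 < q)), add_zero]

theorem sigmaPos_le (q v w : ℕ) (hq : 0 < q) (h : sigmaPos q v ≤ sigmaPos q w) :
    v % q ≤ w % q := by
  rw [← sigmaPos_div q v hq, ← sigmaPos_div q w hq]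
  exact Nat.div_le_div_right h

theorem sigmaPos_inc (q v w : ℕ) (hq : 0 < q) (hvw : v < w)
    (h : sigmaPos q v < sigmaPos q w) : v % q < w % q := by
  rcases (sigmaPos_le q v w hq h.le).lt_or_eq with h1 | h1
  · exact h1
  · exfalso
    have h2 : v / q ≤ w / q := Nat.div_le_div_right hvw.le
    unfold sigmaPos at h
    rw [h1] at h
    omega

theorem sigmaPos_dec (q v w : ℕ) (hq : 0 < q) (hvw : v < w)
    (h : sigmaPos q w < sigmaPos q v) : v / q < w / q := by
  have h2 : v / q ≤ w / q := Nat.div_le_div_right hvw.le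
  rcases h2.lt_or_eq with h1 | h1
  · exact h1
  · exfalso
    have h3 := sigmaPos_le q w v hq h.le
    have e1 := Nat.div_add_mod v q
    have e2 := Nat.div_add_mod w q
    rw [h1] at e1
    omega

theorem sigmaPos_inj (q v w : ℕ) (hv : v < q^2) (hw : w < q^2)
    (h : sigmaPos q v = sigmaPos q w) : v = w := by
  have hq : 0 < q := by
    rcases Nat.eq_zero_or_pos q with rfl | h
    · simp at hv
    · exact h
  have h1 : v % q = w % q := by
    rw [← sigmaPos_div q v hq, ← sigmaPos_div q w hq, h]
  have hv' : v / q < q := Nat.div_lt_of_lt_mul (by rwa [← sq])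
  have hw' : w / q < q := Nat.div_lt_of_lt_mul (by rwa [← sq])
  have h2 : v / q = w / q := by
    unfold sigmaPos at h; rw [h1] at h; omega
  rw [← Nat.div_add_mod v q, ← Nat.div_add_mod w q, h1, h2]

def Cyc (p x y : ℕ) : Prop := (p < x ∧ x < y) ∨ (x < y ∧ y < p) ∨ (y < p ∧ p < x)

theorem card_bound (q : ℕ) (hq : 2 ≤ q) (F : Finset ℕ) (hF : ∀ v ∈ F, v < q^2)
    (hC : ∀ a ∈ F, ∀ b ∈ F, ∀ x ∈ F, ∀ y ∈ F, a < b → b < x → x < y →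
      (((sigmaPos q x < sigmaPos q a ∧ sigmaPos q a < sigmaPos q y) ∨
        (sigmaPos q y < sigmaPos q a ∧ sigmaPos q a < sigmaPos q x)) ↔
       ((sigmaPos q x < sigmaPos q b ∧ sigmaPos q b < sigmaPos q y) ∨
        (sigmaPos q y < sigmaPos q b ∧ sigmaPos q b < sigmaPos q x)))) :
    F.card ≤ 2 * q + 1 := by
  classical
  have hq0 : 0 < q := by omega
  rcases F.eq_empty_or_nonempty with rfl | hne
  · simp
  set z := F.min' hne with hz
  have hzF : z ∈ F := F.min'_mem hne
  have hzle : ∀ v ∈ F, v ≠ z → z < v := fun v hv hn => lt_of_le_of_ne (F.min'_le v hv) hn.symm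
  set R := F.filter (fun v => v ≠ z ∧ ∀ w ∈ F, v < w →
    Cyc (sigmaPos q z) (sigmaPos q v) (sigmaPos q w)) with hR
  set L := F.filter (fun v => v ≠ z ∧ ∀ w ∈ F, v < w →
    Cyc (sigmaPos q z) (sigmaPos q w) (sigmaPos q v)) with hL
  have hinj : ∀ v ∈ F, ∀ w ∈ F, v ≠ w → sigmaPos q v ≠ sigmaPos q w :=
    fun v hv w hw hn h => hn (sigmaPos_inj q v w (hF v hv) (hF w hw) h)
  have hsub : F ⊆ insert z (R ∪ L) := by
    intro v hv
    rw [Finset.mem_insert, Finset.mem_union]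
    by_contra hcon
    push Not at hcon
    obtain ⟨hvz, hvR, hvL⟩ := hcon
    have hvR' : ¬ ∀ w ∈ F, v < w → Cyc (sigmaPos q z) (sigmaPos q v) (sigmaPos q w) :=
      fun h => hvR (Finset.mem_filter.2 ⟨hv, hvz, h⟩)
    have hvL' : ¬ ∀ w ∈ F, v < w → Cyc (sigmaPos q z) (sigmaPos q w) (sigmaPos q v) :=
      fun h => hvL (Finset.mem_filter.2 ⟨hv, hvz, h⟩)
    push Not at hvR' hvL'
    obtain ⟨w, hw, hvw, h1⟩ := hvR'
    obtain ⟨w', hw', hvw', h2⟩ := hvL'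
    have hzv := hzle v hv hvz
    have n1 := hinj z hzF v hv (by omega)
    have n2 := hinj z hzF w hw (by omega)
    have n3 := hinj z hzF w' hw' (by omega)
    have n4 := hinj v hv w hw (by omega)
    have n5 := hinj v hv w' hw' (by omega)
    unfold Cyc at h1 h2
    rcases lt_trichotomy w w' with h | h | h
    · have := hC z hzF v hv w hw w' hw' hzv hvw h
      omega
    · subst h; omega
    · have := hC z hzF v hv w' hw' w hw hzv hvw' h
      omega
  have hRc : R.card ≤ q := by
    rw [← Finset.card_range q]
    refine Finset.card_le_card_of_injOn (fun v => v % q) ?_ ?_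
    · intro v _
      simpa using Nat.mod_lt v hq0
    · have aux : ∀ v ∈ R, ∀ w ∈ R, v < w → v % q ≠ w % q := by
        intro v hv w hw hvw
        obtain ⟨hvF, hvz, hv2⟩ := Finset.mem_filter.1 hv
        obtain ⟨hwF, hwz, -⟩ := Finset.mem_filter.1 hw
        rcases hv2 w hwF hvw with h | h | h
        · exact (sigmaPos_inc q v w hq0 hvw h.2).ne
        · exact (sigmaPos_inc q v w hq0 hvw h.1).ne
        · have := sigmaPos_inc q z v hq0 (hzle v hvF hvz) h.2
          have := sigmaPos_le q w z hq0 h.1.le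
          omega
      intro v hv w hw h
      simp only at h
      by_contra hn
      rcases lt_or_gt_of_ne hn with h' | h'
      · exact aux v hv w hw h' h
      · exact aux w hw v hv h' h.symm
  have hLc : L.card ≤ q := by
    rw [← Finset.card_range q]
    refine Finset.card_le_card_of_injOn
      (fun v => if sigmaPos q v < sigmaPos q z then v / q - 1 else v / q) ?_ ?_
    · intro v hv
      obtain ⟨hvF, hvz, hv2⟩ := Finset.mem_filter.1 hv
      have hv' : v / q < q := Nat.div_lt_of_lt_mul (by rw [← sq]; exact hF v hvF)
      simp only [Finset.coe_range, Set.mem_Iio]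
      split_ifs <;> omega
    · have aux : ∀ v ∈ L, ∀ w ∈ L, v < w →
          (if sigmaPos q v < sigmaPos q z then v / q - 1 else v / q) ≠
          (if sigmaPos q w < sigmaPos q z then w / q - 1 else w / q) := by
        intro v hv w hw hvw
        obtain ⟨hvF, hvz, hv2⟩ := Finset.mem_filter.1 hv
        obtain ⟨hwF, hwz, -⟩ := Finset.mem_filter.1 hw
        have hz0 := Nat.zero_le (z / q)
        rcases hv2 w hwF hvw with h | h | h
        · have := sigmaPos_dec q v w hq0 hvw h.2
          rw [if_neg (by omega), if_neg (by omega)]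
          omega
        · have := sigmaPos_dec q v w hq0 hvw h.1
          have := sigmaPos_dec q z v hq0 (hzle v hvF hvz) h.2
          rw [if_pos (by omega), if_pos (by omega)]
          omega
        · have := sigmaPos_dec q z v hq0 (hzle v hvF hvz) h.1
          have : v / q ≤ w / q := Nat.div_le_div_right hvw.le
          rw [if_pos (by omega), if_neg (by omega)]
          omega
      intro v hv w hw h
      simp only at h
      by_contra hn
      rcases lt_or_gt_of_ne hn with h' | h'
      · exact aux v hv w hw h' h
      · exact aux w hw v hv h' h.symm
  calc F.card ≤ (insert z (R ∪ L)).card := Finset.card_le_card hsub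
    _ ≤ (R ∪ L).card + 1 := Finset.card_insert_le _ _
    _ ≤ R.card + L.card + 1 := by gcongr; exact Finset.card_union_le _ _
    _ ≤ 2 * q + 1 := by omega

theorem upper (q : ℕ) (hq : 2 ≤ q) (δ : Fin (q ^ 2) ⊕ Unit → ℝ × ℝ)
    (h : IsPlaneDrawing (Hq q) δ) : {v | δ v = δHq q v}.ncard ≤ 2 * q + 1 := by
  classical
  by_cases hc : (δ (Sum.inr ())).2 = 0
  · -- at most three fixed vertices: map to the sign of the displacement from `c`
    set c := δ (Sum.inr ()) with hcd
    have hmain : {v | δ v = δHq q v}.ncard ≤ (Finset.univ : Finset SignType).card := by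
      rw [← Set.ncard_coe_finset]
      refine Set.ncard_le_ncard_of_injOn (fun v => SignType.sign ((δ v).1 - c.1)) (by simp) ?_
        (Set.toFinite _)
      have hsnd : ∀ v, δ v = δHq q v → (δ v).2 = 0 := by
        intro v hv
        rw [hv]
        rcases v with v | v <;> rfl
      have hkey : ∀ v w, v ≠ w → δ v = δHq q v → δ w = δHq q w → c.1 < (δ v).1 →
          (δ v).1 ≤ (δ w).1 → False := by
        intro v w hvw hv hw h1 h2
        have hwc : w ≠ Sum.inr () := by
          rintro rfl; rw [← hcd] at h2; linarith
        have hvc : v ≠ Sum.inr () := by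
          rintro rfl; rw [← hcd] at h1; linarith
        obtain ⟨m, rfl⟩ : ∃ m, w = Sum.inl m := by
          rcases w with m | ⟨⟩
          · exact ⟨m, rfl⟩
          · exact absurd rfl hwc
        have hp : 0 < (δ (Sum.inl m)).1 - c.1 := by linarith
        have := h.2.1 _ _ v (Hq_adj_c q m) (by
          rw [← hcd]
          refine ⟨((δ (Sum.inl m)).1 - (δ v).1) / ((δ (Sum.inl m)).1 - c.1),
            ((δ v).1 - c.1) / ((δ (Sum.inl m)).1 - c.1),
            div_nonneg (by linarith) hp.le, div_nonneg (by linarith) hp.le, by field_simp; ring, ?_⟩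
          ext
          · simp; field_simp; ring
          · simp [hsnd _ hv, hsnd _ hw, hc])
        tauto
      have hkey' : ∀ v w, v ≠ w → δ v = δHq q v → δ w = δHq q w → (δ v).1 < c.1 →
          (δ w).1 ≤ (δ v).1 → False := by
        intro v w hvw hv hw h1 h2
        have hwc : w ≠ Sum.inr () := by
          rintro rfl; rw [← hcd] at h2; linarith
        have hvc : v ≠ Sum.inr () := by
          rintro rfl; rw [← hcd] at h1; linarith
        obtain ⟨m, rfl⟩ : ∃ m, w = Sum.inl m := by
          rcases w with m | ⟨⟩
          · exact ⟨m, rfl⟩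
          · exact absurd rfl hwc
        have hp : 0 < c.1 - (δ (Sum.inl m)).1 := by linarith
        have := h.2.1 _ _ v (Hq_adj_c q m) (by
          rw [← hcd]
          refine ⟨((δ v).1 - (δ (Sum.inl m)).1) / (c.1 - (δ (Sum.inl m)).1),
            (c.1 - (δ v).1) / (c.1 - (δ (Sum.inl m)).1),
            div_nonneg (by linarith) hp.le, div_nonneg (by linarith) hp.le, by field_simp; ring, ?_⟩
          ext
          · simp; field_simp; ring
          · simp [hsnd _ hv, hsnd _ hw, hc])
        tauto
      intro v hv w hw hvw
      simp only at hvw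
      by_contra hn
      rcases lt_trichotomy ((δ v).1 - c.1) 0 with hs | hs | hs
      · rw [sign_neg hs, eq_comm, sign_eq_neg_one_iff] at hvw
        rcases le_total (δ v).1 (δ w).1 with hl | hl
        · exact hkey' w v (Ne.symm hn) hw hv (by linarith) hl
        · exact hkey' v w hn hv hw (by linarith) hl
      · rw [hs, sign_zero, eq_comm, sign_eq_zero_iff] at hvw
        apply hn
        apply h.1
        ext
        · linarith
        · rw [hsnd v hv, hsnd w hw]
      · rw [sign_pos hs, eq_comm, sign_eq_one_iff] at hvw
        rcases le_total (δ v).1 (δ w).1 with hl | hl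
        · exact hkey v w hn hv hw (by linarith) hl
        · exact hkey w v (Ne.symm hn) hw hv (by linarith) hl
    have : (Finset.univ : Finset SignType).card = 3 := rfl
    omega
  · set F : Finset ℕ := (Finset.univ.filter
      (fun i : Fin (q^2) => δ (Sum.inl i) = δHq q (Sum.inl i))).image (fun i => i.1) with hFd
    have hmem : ∀ v ∈ F, ∃ hv : v < q^2, δ (Sum.inl ⟨v, hv⟩) = ((sigmaPos q v : ℝ), 0) := by
      intro v hv
      simp only [hFd, Finset.mem_image, Finset.mem_filter, Finset.mem_univ, true_and] at hv
      obtain ⟨i, hi, rfl⟩ := hv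
      exact ⟨i.2, hi⟩
    have hF := card_bound q hq F (fun v hv => (hmem v hv).1) (by
      intro a ha b hb x hx y hy hab hbx hxy
      obtain ⟨ha1, ha2⟩ := hmem a ha
      obtain ⟨hb1, hb2⟩ := hmem b hb
      obtain ⟨hx1, hx2⟩ := hmem x hx
      obtain ⟨hy1, hy2⟩ := hmem y hy
      have := cond_of_plane q δ h hc ⟨a, ha1⟩ ⟨b, hb1⟩ ⟨x, hx1⟩ ⟨y, hy1⟩ hab.le hbx hxy
        _ _ _ _ ha2 hb2 hx2 hy2
      exact_mod_cast this)
    refine le_trans ?_ hF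
    rw [← Set.ncard_coe_finset]
    refine Set.ncard_le_ncard_of_injOn (Sum.elim (fun i => i.1) (fun _ => 0)) ?_ ?_ (Set.toFinite _)
    · intro v hv
      rcases v with i | ⟨⟩
      · simp only [hFd, Finset.coe_image, Finset.coe_filter, Sum.elim_inl]
        exact ⟨i, ⟨Finset.mem_univ _, hv⟩, rfl⟩
      · exfalso; apply hc
        have : δ (Sum.inr ()) = δHq q (Sum.inr ()) := hv
        rw [this]; rfl
    · intro v hv w hw hvw
      have hcc : δ (Sum.inr ()) ≠ δHq q (Sum.inr ()) := by
        intro h'; apply hc; rw [h']; rfl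
      rcases v with i | ⟨⟩
      · rcases w with j | ⟨⟩
        · simp at hvw; rw [Fin.ext hvw]
        · exact absurd hw hcc
      · exact absurd hv hcc
noncomputable def xx (q m : ℕ) : ℝ :=
  if m < q then (m : ℝ) * q + q - 1 else if m = q then (q : ℝ) ^ 2 else q - 1 - (m : ℝ) / q

noncomputable def yy (q m : ℕ) : ℝ := if m = q then -1 else 0

noncomputable def dlow (q : ℕ) : Fin (q ^ 2) ⊕ Unit → ℝ × ℝ
  | Sum.inr _ => ((q : ℝ) ^ 2, 1)
  | Sum.inl m => (xx q m.1, yy q m.1)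

theorem xx_small {q m : ℕ} (h : m < q) : xx q m = (m : ℝ) * q + q - 1 := by simp [xx, h]
theorem xx_q (q : ℕ) : xx q q = (q : ℝ) ^ 2 := by simp [xx]
theorem xx_big {q m : ℕ} (h : q < m) : xx q m = q - 1 - (m : ℝ) / q := by
  rw [xx, if_neg (by omega), if_neg (by omega)]
theorem yy_q (q : ℕ) : yy q q = -1 := by simp [yy]
theorem yy_ne {q m : ℕ} (h : m ≠ q) : yy q m = 0 := by simp [yy, h]

theorem xx_cross {q m k : ℕ} (hq : 2 ≤ q) (hm : q < m) (hk : k < q) : xx q m < xx q k := by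
  rw [xx_big hm, xx_small hk]
  have h0 : (0:ℝ) < q := by positivity
  have h1 : (0:ℝ) < (m:ℝ) / q := by
    have : (0:ℝ) < m := by exact_mod_cast (by omega : 0 < m)
    positivity
  have h2 : (0:ℝ) ≤ (k:ℝ) * q := by positivity
  linarith

theorem xx_small_lt {q m k : ℕ} (hk : k < q) (hmk : m < k) : xx q m < xx q k := by
  rw [xx_small hk, xx_small (hmk.trans hk)]
  have h0 : (0:ℝ) < q := by exact_mod_cast (by omega : 0 < q)
  have h1 : (m:ℝ) < k := by exact_mod_cast hmk
  nlinarith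

theorem xx_big_lt {q m k : ℕ} (hq : 2 ≤ q) (hm : q < m) (hmk : m < k) : xx q k < xx q m := by
  rw [xx_big hm, xx_big (hm.trans hmk)]
  have h0 : (0:ℝ) < q := by positivity
  have h1 : (m:ℝ) < k := by exact_mod_cast hmk
  have : (m:ℝ) / q < k / q := by gcongr
  linarith

theorem xx_lt {q m : ℕ} (hq : 2 ≤ q) (hm : m ≠ q) : xx q m < (q:ℝ)^2 := by
  have h0 : (2:ℝ) ≤ q := by exact_mod_cast hq
  have key : xx q (q-1) < (q:ℝ)^2 := by
    rw [xx_small (by omega)]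
    push_cast [Nat.cast_sub (by omega : 1 ≤ q)]
    nlinarith
  rcases lt_or_gt_of_ne hm with h | h
  · rcases (by omega : m = q - 1 ∨ m < q - 1) with rfl | h'
    · exact key
    · exact (xx_small_lt (by omega) h').trans key
  · exact (xx_cross hq h (by omega)).trans key

theorem xx_small_le {q m k : ℕ} (hm : m < q) (h : xx q m ≤ xx q k) (hk : k < q) : m ≤ k := by
  by_contra hc
  push Not at hc
  exact absurd (xx_small_lt hm hc) (not_lt.2 h)

theorem xx_big_le {q m k : ℕ} (hq : 2 ≤ q) (h : xx q m ≤ xx q k) (hm : q < m) : k ≤ m := by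
  by_contra hc
  push Not at hc
  exact absurd (xx_big_lt hq hm hc) (not_lt.2 h)

theorem xx_inj {q m k : ℕ} (hq : 2 ≤ q) (hm : m ≠ q) (hk : k ≠ q) (h : xx q m = xx q k) : m = k := by
  rcases lt_or_gt_of_ne hm with h1 | h1 <;> rcases lt_or_gt_of_ne hk with h2 | h2
  · exact le_antisymm (xx_small_le h1 h.le h2) (xx_small_le h2 h.ge h1)
  · exact absurd h (xx_cross hq h2 h1).ne'
  · exact absurd h (xx_cross hq h1 h2).ne
  · exact le_antisymm (xx_big_le hq h.ge h2) (xx_big_le hq h.le h1)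

theorem spoke_mem {q m : ℕ} {p : ℝ × ℝ}
    (h : p ∈ segment ℝ ((q:ℝ)^2, (1:ℝ)) (xx q m, yy q m)) :
    (m ≠ q ∧ 0 ≤ p.2 ∧ p.2 ≤ 1 ∧ p.1 = (q:ℝ)^2 + (1 - p.2) * (xx q m - (q:ℝ)^2)) ∨
    (m = q ∧ p.1 = (q:ℝ)^2) := by
  obtain ⟨s, t, hs, ht, hst, rfl⟩ := h
  obtain rfl : s = 1 - t := by linarith
  by_cases hm : m = q
  · right
    refine ⟨hm, ?_⟩
    rw [hm, xx_q]; simp; ring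
  · left
    rw [yy_ne hm]
    simp
    refine ⟨hm, by linarith, ht, by ring⟩

theorem path_mem {q k : ℕ} (hq : 2 ≤ q) {p : ℝ × ℝ}
    (h : p ∈ segment ℝ (xx q k, yy q k) (xx q (k+1), yy q (k+1))) :
    (k + 1 < q ∧ p.2 = 0 ∧ xx q k ≤ p.1 ∧ p.1 ≤ xx q (k+1)) ∨
    (q < k ∧ p.2 = 0 ∧ xx q (k+1) ≤ p.1 ∧ p.1 ≤ xx q k) ∨
    (k + 1 = q ∧ p.2 ≤ 0 ∧ p.1 = (1 + p.2) * xx q k - p.2 * (q:ℝ)^2) ∨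
    (k = q ∧ p.2 ≤ 0 ∧ p.1 = (1 + p.2) * xx q (k+1) - p.2 * (q:ℝ)^2) := by
  obtain ⟨s, t, hs, ht, hst, rfl⟩ := h
  obtain rfl : s = 1 - t := by linarith
  rcases (by omega : k + 1 < q ∨ k + 1 = q ∨ k = q ∨ q < k) with h | h | h | h
  · left
    have := xx_small_lt h (Nat.lt_succ_self k)
    rw [yy_ne (by omega), yy_ne (by omega)]
    simp only [Prod.fst_add, Prod.smul_fst, smul_eq_mul, Prod.snd_add, Prod.smul_snd]
    refine ⟨h, by ring, ?_, ?_⟩ <;> nlinarith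
  · right; right; left
    rw [h, yy_q, yy_ne (by omega), xx_q]
    simp only [Prod.fst_add, Prod.smul_fst, smul_eq_mul, Prod.snd_add, Prod.smul_snd]
    exact ⟨by trivial, by linarith, by ring⟩
  · right; right; right
    rw [h, yy_q, yy_ne (by omega), xx_q]
    simp only [Prod.fst_add, Prod.smul_fst, smul_eq_mul, Prod.snd_add, Prod.smul_snd]
    exact ⟨by trivial, by linarith, by ring⟩
  · right; left
    have := xx_big_lt hq h (Nat.lt_succ_self k)
    rw [yy_ne (by omega), yy_ne (by omega)]
    simp only [Prod.fst_add, Prod.smul_fst, smul_eq_mul, Prod.snd_add, Prod.smul_snd]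
    refine ⟨h, by ring, ?_, ?_⟩ <;> nlinarith

theorem spoke_spoke {q m k : ℕ} (hq : 2 ≤ q) (hmk : m ≠ k) {p : ℝ × ℝ}
    (h : p ∈ segment ℝ ((q:ℝ)^2, (1:ℝ)) (xx q m, yy q m))
    (h' : p ∈ segment ℝ ((q:ℝ)^2, (1:ℝ)) (xx q k, yy q k)) : p = ((q:ℝ)^2, 1) := by
  rcases spoke_mem h with ⟨hm, h1, h2, h3⟩ | ⟨hm, h3⟩ <;>
  rcases spoke_mem h' with ⟨hk, h1', h2', h3'⟩ | ⟨hk, h3'⟩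
  · have : (1 - p.2) * (xx q m - xx q k) = 0 := by linarith
    rcases mul_eq_zero.1 this with h | h
    · ext
      · rw [h3, h]; simp
      · simp; linarith
    · exact absurd (xx_inj hq hm hk (by linarith)) hmk
  · have : (1 - p.2) * (xx q m - (q:ℝ)^2) = 0 := by linarith
    rcases mul_eq_zero.1 this with h | h
    · ext
      · rw [h3, h]; simp
      · simp; linarith
    · exact absurd (xx_lt hq hm) (by linarith)
  · have : (1 - p.2) * (xx q k - (q:ℝ)^2) = 0 := by linarith
    rcases mul_eq_zero.1 this with h | h
    · ext
      · rw [h3', h]; simp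
      · simp; linarith
    · exact absurd (xx_lt hq hk) (by linarith)
  · omega

theorem spoke_path {q m k : ℕ} (hq : 2 ≤ q) {p : ℝ × ℝ}
    (h : p ∈ segment ℝ ((q:ℝ)^2, (1:ℝ)) (xx q m, yy q m))
    (h' : p ∈ segment ℝ (xx q k, yy q k) (xx q (k+1), yy q (k+1))) :
    p = (xx q m, yy q m) ∧ (m = k ∨ m = k + 1) := by
  rcases spoke_mem h with ⟨hm, h1, h2, h3⟩ | ⟨hm, h3⟩
  · have main : p.2 = 0 → p = (xx q m, yy q m) ∧ p.1 = xx q m := by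
      intro h0
      have e : p.1 = xx q m := by rw [h3, h0]; ring
      exact ⟨Prod.ext e (by rw [h0, yy_ne hm]), e⟩
    rcases path_mem hq h' with ⟨hk, e0, e1, e2⟩ | ⟨hk, e0, e1, e2⟩ | ⟨hk, e0, e1⟩ | ⟨hk, e0, e1⟩
    · obtain ⟨r1, r2⟩ := main e0
      refine ⟨r1, ?_⟩
      rw [r2] at e1 e2
      rcases lt_or_gt_of_ne hm with hl | hl
      · have := xx_small_le (by omega) e1 hl
        have := xx_small_le hl e2 hk
        omega
      · have := xx_cross hq hl (by omega : k < q)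
        linarith
    · obtain ⟨r1, r2⟩ := main e0
      refine ⟨r1, ?_⟩
      rw [r2] at e1 e2
      rcases lt_or_gt_of_ne hm with hl | hl
      · have := xx_cross hq hk hl
        linarith
      · have := xx_big_le hq e1 (by omega)
        have := xx_big_le hq e2 hl
        omega
    · have h0 : p.2 = 0 := le_antisymm e0 h1
      obtain ⟨r1, r2⟩ := main h0
      refine ⟨r1, Or.inl (xx_inj hq hm (by omega) ?_)⟩
      rw [← r2, e1, h0]; ring
    · have h0 : p.2 = 0 := le_antisymm e0 h1
      obtain ⟨r1, r2⟩ := main h0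
      refine ⟨r1, Or.inr (xx_inj hq hm (by omega) ?_)⟩
      rw [← r2, e1, h0]; ring
  · rw [hm, xx_q, yy_q]
    rcases path_mem hq h' with ⟨hk, e0, e1, e2⟩ | ⟨hk, e0, e1, e2⟩ | ⟨hk, e0, e1⟩ | ⟨hk, e0, e1⟩
    · have := xx_lt hq (by omega : k + 1 ≠ q)
      linarith
    · have := xx_lt hq (by omega : k ≠ q)
      linarith
    · have hx := xx_lt hq (by omega : k ≠ q)
      have : (1 + p.2) * (xx q k - (q:ℝ)^2) = 0 := by linarith
      rcases mul_eq_zero.1 this with h | h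
      · exact ⟨Prod.ext h3 (by simp; linarith), Or.inr hk.symm⟩
      · linarith
    · have hx := xx_lt hq (by omega : k + 1 ≠ q)
      have : (1 + p.2) * (xx q (k+1) - (q:ℝ)^2) = 0 := by linarith
      rcases mul_eq_zero.1 this with h | h
      · exact ⟨Prod.ext h3 (by simp; linarith), Or.inl hk.symm⟩
      · linarith

theorem path_path {q k l : ℕ} (hq : 2 ≤ q) (hkl : k < l) {p : ℝ × ℝ}
    (h : p ∈ segment ℝ (xx q k, yy q k) (xx q (k+1), yy q (k+1)))
    (h' : p ∈ segment ℝ (xx q l, yy q l) (xx q (l+1), yy q (l+1))) :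
    l = k + 1 ∧ p = (xx q l, yy q l) := by
  rcases path_mem hq h with ⟨hk, e0, e1, e2⟩ | ⟨hk, e0, e1, e2⟩ | ⟨hk, e0, e1⟩ | ⟨hk, e0, e1⟩
  · rcases path_mem hq h' with ⟨hl, f0, f1, f2⟩ | ⟨hl, f0, f1, f2⟩ | ⟨hl, f0, f1⟩ | ⟨hl, f0, f1⟩
    · have := xx_small_le (by omega) (f1.trans e2) hk
      have hlk : l = k + 1 := by omega
      refine ⟨hlk, Prod.ext (le_antisymm (by rw [hlk]; exact e2) f1) ?_⟩
      rw [yy_ne (by omega)]; exact f0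
    · have := xx_cross hq hl (by omega : k < q)
      linarith
    · rw [e0] at f1
      have f1 : p.1 = xx q l := by rw [f1]; ring
      have := xx_small_le (by omega) (f1.symm.le.trans e2) hk
      refine ⟨by omega, Prod.ext f1 ?_⟩
      rw [yy_ne (by omega)]; exact e0
    · rw [e0] at f1
      have f1 : p.1 = xx q (l+1) := by rw [f1]; ring
      have := xx_cross hq (by omega : q < l + 1) (by omega : k < q)
      linarith
  · rcases path_mem hq h' with ⟨hl, f0, f1, f2⟩ | ⟨hl, f0, f1, f2⟩ | ⟨hl, f0, f1⟩ | ⟨hl, f0, f1⟩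
    · omega
    · have := xx_big_le hq (e1.trans f2) (by omega)
      have hlk : l = k + 1 := by omega
      refine ⟨hlk, Prod.ext (le_antisymm f2 (by rw [hlk]; exact e1)) ?_⟩
      rw [yy_ne (by omega)]; exact f0
    · omega
    · omega
  · rcases path_mem hq h' with ⟨hl, f0, f1, f2⟩ | ⟨hl, f0, f1, f2⟩ | ⟨hl, f0, f1⟩ | ⟨hl, f0, f1⟩
    · omega
    · rw [f0] at e1
      have := xx_cross hq hl (by omega : k < q)
      linarith
    · omega
    · refine ⟨by omega, ?_⟩
      have hx := xx_cross hq (by omega : q < l + 1) (by omega : k < q)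
      have : (1 + p.2) * (xx q k - xx q (l+1)) = 0 := by linarith
      rcases mul_eq_zero.1 this with h | h
      · have h2 : p.2 = -1 := by linarith
        rw [hl, xx_q, yy_q]
        exact Prod.ext (by rw [e1, h2]; ring) h2
      · linarith
  · rcases path_mem hq h' with ⟨hl, f0, f1, f2⟩ | ⟨hl, f0, f1, f2⟩ | ⟨hl, f0, f1⟩ | ⟨hl, f0, f1⟩
    · omega
    · rw [f0] at e1
      have e1 : p.1 = xx q (k+1) := by rw [e1]; ring
      have := xx_big_le hq (e1.symm.le.trans f2) (by omega)
      have hlk : l = k + 1 := by omega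
      refine ⟨hlk, Prod.ext (by rw [hlk]; exact e1) ?_⟩
      rw [yy_ne (by omega)]; exact f0
    · omega
    · omega

def Meets {V : Type*} (δ : V → ℝ × ℝ) (u v a b : V) : Prop :=
  ({u, v} : Set V) ≠ ({a, b} : Set V) →
    ∀ p : ℝ × ℝ, p ∈ segment ℝ (δ u) (δ v) → p ∈ segment ℝ (δ a) (δ b) →
      ∃ w : V, (w = u ∨ w = v) ∧ (w = a ∨ w = b) ∧ p = δ w

theorem Meets.swap {V : Type*} {δ : V → ℝ × ℝ} {u v a b : V} (h : Meets δ u v a b) :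
    Meets δ v u a b := by
  intro hne p hp hp'
  rw [Set.pair_comm] at hne
  rw [segment_symm] at hp
  obtain ⟨w, h1, h2, h3⟩ := h hne p hp hp'
  exact ⟨w, h1.symm, h2, h3⟩

theorem Meets.symm {V : Type*} {δ : V → ℝ × ℝ} {u v a b : V} (h : Meets δ u v a b) :
    Meets δ a b u v := by
  intro hne p hp hp'
  obtain ⟨w, h1, h2, h3⟩ := h hne.symm p hp' hp
  exact ⟨w, h2, h1, h3⟩

def Std (q : ℕ) (u v : Fin (q^2) ⊕ Unit) : Prop :=
  (u = Sum.inr () ∧ ∃ m, v = Sum.inl m) ∨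
  (∃ (k : ℕ) (h : k + 1 < q^2), u = Sum.inl ⟨k, by omega⟩ ∧ v = Sum.inl ⟨k+1, h⟩)

theorem std_of_adj {q : ℕ} {u v : Fin (q^2) ⊕ Unit} (h : (Hq q).Adj u v) :
    Std q u v ∨ Std q v u := by
  rw [Hq, SimpleGraph.fromRel_adj] at h
  obtain ⟨-, h⟩ := h
  rcases u with ⟨i, hi⟩ | ⟨⟩ <;> rcases v with ⟨j, hj⟩ | ⟨⟩
  · rcases h with h | h
    · simp only at h
      subst h
      exact Or.inl (Or.inr ⟨i, hj, rfl, rfl⟩)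
    · simp only at h
      subst h
      exact Or.inr (Or.inr ⟨j, hi, rfl, rfl⟩)
  · exact Or.inr (Or.inl ⟨rfl, _, rfl⟩)
  · exact Or.inl (Or.inl ⟨rfl, _, rfl⟩)
  · simp at h

theorem meets_sp (q : ℕ) (hq : 2 ≤ q) (m : Fin (q^2)) (k : ℕ) (h : k + 1 < q^2) :
    Meets (dlow q) (Sum.inr ()) (Sum.inl m) (Sum.inl ⟨k, by omega⟩) (Sum.inl ⟨k+1, h⟩) := by
  intro _ p hp hp'
  obtain ⟨h1, h2⟩ := spoke_path (m := m.1) (k := k) hq hp hp'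
  refine ⟨Sum.inl m, Or.inr rfl, ?_, h1⟩
  rcases h2 with h2 | h2
  · left; congr 1; exact Fin.ext h2
  · right; congr 1; exact Fin.ext h2

theorem meets_pp (q : ℕ) (hq : 2 ≤ q) (k : ℕ) (h : k + 1 < q^2) (l : ℕ) (h' : l + 1 < q^2)
    (hkl : k < l) :
    Meets (dlow q) (Sum.inl ⟨k, by omega⟩) (Sum.inl ⟨k+1, h⟩) (Sum.inl ⟨l, by omega⟩)
      (Sum.inl ⟨l+1, h'⟩) := by
  intro _ p hp hp'
  obtain ⟨h1, h2⟩ := path_path (k := k) (l := l) hq hkl hp hp'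
  subst h1
  exact ⟨_, Or.inr rfl, Or.inl rfl, h2⟩

theorem meets_std {q : ℕ} (hq : 2 ≤ q) {u v a b : Fin (q^2) ⊕ Unit} (h : Std q u v)
    (h' : Std q a b) : Meets (dlow q) u v a b := by
  rcases h with ⟨rfl, m, rfl⟩ | ⟨k, hk, rfl, rfl⟩ <;>
  rcases h' with ⟨rfl, m', rfl⟩ | ⟨k', hk', rfl, rfl⟩
  · intro hne p hp hp'
    have hmm : m.1 ≠ m'.1 := by
      intro he; exact hne (by rw [Fin.ext he])
    exact ⟨Sum.inr (), Or.inl rfl, Or.inl rfl, spoke_spoke hq hmm hp hp'⟩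
  · exact meets_sp q hq m k' hk'
  · exact (meets_sp q hq m' k hk).symm
  · rcases lt_trichotomy k k' with h | h | h
    · exact meets_pp q hq k hk k' hk' h
    · subst h
      exact fun hne => absurd rfl hne
    · exact (meets_pp q hq k' hk' k hk h).symm

theorem dlow_inj {q : ℕ} (hq : 2 ≤ q) : Function.Injective (dlow q) := by
  have hc : ∀ m : ℕ, (xx q m, yy q m) ≠ ((q:ℝ)^2, (1:ℝ)) := by
    intro m h
    have := congrArg Prod.snd h
    simp only [yy] at this
    split_ifs at this <;> norm_num at this
  intro u v h
  rcases u with i | ⟨⟩ <;> rcases v with j | ⟨⟩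
  · have h1 : xx q i = xx q j := congrArg Prod.fst h
    have h2 : yy q i = yy q j := congrArg Prod.snd h
    congr 1
    apply Fin.ext
    by_cases hi : i.1 = q <;> by_cases hj : j.1 = q
    · omega
    · rw [hi, yy_q, yy_ne hj] at h2; norm_num at h2
    · rw [hj, yy_q, yy_ne hi] at h2; norm_num at h2
    · exact xx_inj hq hi hj h1
  · exact absurd h (hc _)
  · exact absurd h.symm (hc _)
  · rfl

theorem dlow_plane {q : ℕ} (hq : 2 ≤ q) : IsPlaneDrawing (Hq q) (dlow q) := by
  have h3 : ∀ u v a b, (Hq q).Adj u v → (Hq q).Adj a b → Meets (dlow q) u v a b := by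
    intro u v a b h h'
    rcases std_of_adj h with h | h <;> rcases std_of_adj h' with h' | h'
    · exact meets_std hq h h'
    · exact (meets_std hq h h').symm.swap.symm
    · exact (meets_std hq h h').swap
    · exact (meets_std hq h h').swap.symm.swap.symm
  refine ⟨dlow_inj hq, ?_, h3⟩
  intro u v w huv hw
  by_contra hn
  push Not at hn
  obtain ⟨z, hz⟩ : ∃ z, (Hq q).Adj w z := by
    rcases w with i | ⟨⟩
    · exact ⟨_, (Hq_adj_c q i).symm⟩
    · exact ⟨_, Hq_adj_c q ⟨0, by positivity⟩⟩
  obtain ⟨w', h1, h2, h4⟩ := h3 u v w z huv hz (by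
    intro he
    have : w ∈ ({u, v} : Set _) := by rw [he]; simp
    simp at this
    tauto) _ hw (left_mem_segment _ _ _)
  have := dlow_inj hq h4
  subst this
  tauto

theorem lower {q : ℕ} (hq : 2 ≤ q) : 2 * q - 2 ≤ {v | dlow q v = δHq q v}.ncard := by
  classical
  have hq0 : 0 < q := by omega
  have e : 2 * q - 2 = (Finset.range (2 * q - 2)).card := (Finset.card_range _).symm
  rw [e, ← Set.ncard_coe_finset]
  have hlt : ∀ n, n < 2 * q - 2 → (if n < q then n else (n - q + 2) * q) < q^2 := by
    intro n hn
    split_ifs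
    · nlinarith
    · rw [sq]; exact Nat.mul_lt_mul_of_pos_right (by omega) hq0
  refine Set.ncard_le_ncard_of_injOn
    (fun n => if h : n < 2 * q - 2 then Sum.inl ⟨if n < q then n else (n - q + 2) * q, hlt n h⟩
      else Sum.inr ()) ?_ ?_ (Set.toFinite _)
  · intro n hn
    have hn : n < 2 * q - 2 := by simpa using hn
    simp only [dif_pos hn, Set.mem_setOf_eq, dlow, δHq]
    by_cases h : n < q
    · simp only [if_pos h]
      rw [xx_small h, yy_ne (by omega), sigmaPos, Nat.mod_eq_of_lt h, Nat.div_eq_of_lt h]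
      ext
      · simp only [Nat.sub_zero]
        push_cast [Nat.cast_sub (by omega : 1 ≤ q)]
        ring
      · rfl
    · simp only [if_neg h]
      have hb : q < (n - q + 2) * q := by nlinarith [Nat.zero_le (n - q)]
      rw [xx_big hb, yy_ne hb.ne', sigmaPos, Nat.mul_mod_left, Nat.mul_div_cancel _ hq0]
      have hr : (q:ℝ) ≠ 0 := by positivity
      have : n - q + 2 ≤ q - 1 := by omega
      push_cast [Nat.cast_sub this, Nat.cast_sub (by omega : 1 ≤ q)]
      ext
      · simp; field_simp
      · rfl
  · intro n hn m hm h
    have hn : n < 2 * q - 2 := by simpa using hn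
    have hm : m < 2 * q - 2 := by simpa using hm
    simp only [dif_pos hn, dif_pos hm, Sum.inl.injEq, Fin.mk.injEq] at h
    split_ifs at h with h1 h2 h2
    · exact h
    · nlinarith [Nat.zero_le (m - q)]
    · nlinarith [Nat.zero_le (n - q)]
    · have := Nat.eq_of_mul_eq_mul_right hq0 h
      omega
/-- For `q ≥ 2`: the graph `H_q` is planar, every plane straight-line drawing of `H_q`
fixes at most `2q + 1` vertices of the drawing `δHq q`, and some plane straight-line
drawing fixes at least `2q - 2` of them; in other words
`2q - 2 ≤ fix(H_q, δ) ≤ 2q + 1`. -/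
theorem fix_Hq (q : ℕ) (hq : 2 ≤ q) :
    (∃ δ' : Fin (q ^ 2) ⊕ Unit → ℝ × ℝ, IsPlaneDrawing (Hq q) δ') ∧
    (∀ δ' : Fin (q ^ 2) ⊕ Unit → ℝ × ℝ, IsPlaneDrawing (Hq q) δ' →
      {v | δ' v = δHq q v}.ncard ≤ 2 * q + 1) ∧
    (∃ δ' : Fin (q ^ 2) ⊕ Unit → ℝ × ℝ, IsPlaneDrawing (Hq q) δ' ∧
      2 * q - 2 ≤ {v | δ' v = δHq q v}.ncard) := by
  exact ⟨⟨_, dlow_plane hq⟩, fun δ h => upper q hq δ h, ⟨_, dlow_plane hq, lower hq⟩⟩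
end
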